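/- Let φ be a Drinfeld module of rank r over 𝕂, let x_1, …, x_r be a strict 𝔽_q-basis of φ[t], let N ≥ 1 and ξ_1, …, ξ_r ∈ φ[t^N] satisfy, for each j: |ξ_j| < R_φ; φ_{t^{N−1}}(ξ_j) = x_j; and deg φ_{t^{N−1}}(ξ_j) > ⋯ > deg φ_t(ξ_j) > deg ξ_j; and let h_j := Σ_{m=0}^{N−1} φ_{t^{N−1−m}}(ξ_j) t^m, B := (h_j^{(i−1)})_{1≤i,j≤r}. Then the infinite product Π := B ∏_{n=0}^∞ (B^{−1} Θ^{−1} B^{(1)})^{(n)}, in which each successive factor is multiplied on the right, converges with respect to the Gauss norm on Mat_r(𝕋), lies in GL_r(𝕋), and satisfies Π^{(1)} = Θ Π; that is, Π is a rigid analytic trivialization for φ. -/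

import Mathlib

open Filter

set_option maxHeartbeats 1000000
set_option synthInstance.maxHeartbeats 400000

noncomputable section

namespace DrinfeldRAT

variable (𝕂 : Type) [NontriviallyNormedField 𝕂]

/-- `deg x := log_q ‖x‖`. -/
def degK (q : ℕ) (x : 𝕂) : ℝ := Real.logb q ‖x‖

/-- The action of `φ_t` on `𝕂`: `φ_t(x) = θ x + A_1 x^q + ⋯ + A_r x^{q^r}`. -/
def phiT (q r : ℕ) (θ : 𝕂) (A : ℕ → 𝕂) (x : 𝕂) : 𝕂 :=
  θ * x + ∑ i ∈ Finset.Icc 1 r, A i * x ^ q ^ i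

/-- Membership in `N(φ) = {1 ≤ i ≤ r : A_i ≠ 0}`. -/
def inNphi (r : ℕ) (A : ℕ → 𝕂) (i : ℕ) : Prop := 1 ≤ i ∧ i ≤ r ∧ A i ≠ 0

/-- `μ_n = (deg A_n − q^n)/(q^n − 1)`. -/
def muPhi (q : ℕ) (A : ℕ → 𝕂) (n : ℕ) : ℝ :=
  (degK 𝕂 q (A n) - (q : ℝ) ^ n) / ((q : ℝ) ^ n - 1)

/-- `m` is the smallest index in `N(φ)` at which `μ` is maximal on `N(φ)`. -/
def IsMuIndex (q r : ℕ) (A : ℕ → 𝕂) (m : ℕ) : Prop :=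
  inNphi 𝕂 r A m ∧ (∀ i, inNphi 𝕂 r A i → muPhi 𝕂 q A i ≤ muPhi 𝕂 q A m) ∧
    ∀ m', inNphi 𝕂 r A m' → (∀ i, inNphi 𝕂 r A i → muPhi 𝕂 q A i ≤ muPhi 𝕂 q A m') → m ≤ m'

/-- `R_φ = q^{−μ_m}` (a real power). -/
def Rphi (q : ℕ) (A : ℕ → 𝕂) (m : ℕ) : ℝ := (q : ℝ) ^ (-(muPhi 𝕂 q A m))

/-- The coefficient of `x^{q^n}` in `φ_t(x)`, with `A₀ = θ`. -/
def Acoef (θ : 𝕂) (A : ℕ → 𝕂) (n : ℕ) : 𝕂 := if n = 0 then θ else A n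

/-- Data of the Newton polygon of `φ_t(x)`: vertices `(q^{d_j}, −deg A_{d_j})`,
`0 = d_0 < d_1 < ⋯ < d_s = r`, with strictly increasing edge slopes `λ_1 < ⋯ < λ_s`,
such that every point `(q^n, −deg A_n)` (for `A_n ≠ 0`, including `n = 0`) lies on or
above each edge line (lower convex hull). -/
structure NewtonData (q r : ℕ) (θ : 𝕂) (A : ℕ → 𝕂) where
  s : ℕ
  d : ℕ → ℕ
  lam : ℕ → ℝ
  s_pos : 0 < s
  d_zero : d 0 = 0
  d_last : d s = r
  d_mono : ∀ j < s, d j < d (j + 1)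
  vertex_ne : ∀ j, 1 ≤ j → j ≤ s → A (d j) ≠ 0
  slope_eq : ∀ j, 1 ≤ j → j ≤ s →
    lam j = (degK 𝕂 q (Acoef 𝕂 θ A (d (j - 1))) - degK 𝕂 q (Acoef 𝕂 θ A (d j))) /
      ((q : ℝ) ^ d j - (q : ℝ) ^ d (j - 1))
  lam_mono : ∀ j, 1 ≤ j → j + 1 ≤ s → lam j < lam (j + 1)
  hull : ∀ n ≤ r, Acoef 𝕂 θ A n ≠ 0 → ∀ j, 1 ≤ j → j ≤ s →
    lam j * ((q : ℝ) ^ n - (q : ℝ) ^ d j) + (-(degK 𝕂 q (Acoef 𝕂 θ A (d j)))) ≤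
      -(degK 𝕂 q (Acoef 𝕂 θ A n))

/-- `x 0, …, x (r−1)` is an `𝔽_q`-basis of `φ[t]` (`𝔽_q ⊆ 𝕂` is the set of `c` with `c^q = c`). -/
def IsFqBasis (q r : ℕ) (θ : 𝕂) (A : ℕ → 𝕂) (x : Fin r → 𝕂) : Prop :=
  (∀ j, phiT 𝕂 q r θ A (x j) = 0) ∧
    ∀ y, phiT 𝕂 q r θ A y = 0 →
      ∃! c : Fin r → 𝕂, (∀ j, c j ^ q = c j) ∧ y = ∑ j, c j * x j

/-- Strictness of a basis of `φ[t]` with respect to Newton polygon data: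
`deg x_j = λ_k` for `d_{k−1} < j ≤ d_k` (here `x` is indexed from `0`). -/
def IsStrict (q r : ℕ) (θ : 𝕂) (A : ℕ → 𝕂) (ND : NewtonData 𝕂 q r θ A)
    (x : Fin r → 𝕂) : Prop :=
  ∀ k, 1 ≤ k → k ≤ ND.s → ∀ j : Fin r, ND.d (k - 1) ≤ (j : ℕ) → (j : ℕ) < ND.d k →
    degK 𝕂 q (x j) = ND.lam k

/-- The conditions of Proposition `good-xi` on `ξ_1, …, ξ_r ∈ φ[t^N]`:
`|ξ_j| < R_φ`, `φ_{t^{N−1}}(ξ_j) = x_j`, and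
`deg φ_{t^{N−1}}(ξ_j) > ⋯ > deg φ_t(ξ_j) > deg ξ_j`. -/
def GoodXi (q r N : ℕ) (θ : 𝕂) (A : ℕ → 𝕂) (m : ℕ) (x ξ : Fin r → 𝕂) : Prop :=
  ∀ j, (phiT 𝕂 q r θ A)^[N] (ξ j) = 0 ∧
    ‖ξ j‖ < Rphi 𝕂 q A m ∧
    (phiT 𝕂 q r θ A)^[N - 1] (ξ j) = x j ∧
    ∀ i, i + 1 ≤ N - 1 →
      degK 𝕂 q ((phiT 𝕂 q r θ A)^[i] (ξ j)) < degK 𝕂 q ((phiT 𝕂 q r θ A)^[i + 1] (ξ j))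

/-- Gauss norm of a power series. -/
def gnorm (f : PowerSeries 𝕂) : ℝ := ⨆ i : ℕ, ‖PowerSeries.coeff i f‖

/-- Membership in the Tate algebra `𝕋`: coefficients tend to `0`. -/
def IsTate (f : PowerSeries 𝕂) : Prop :=
  Tendsto (fun i => ‖PowerSeries.coeff i f‖) atTop (nhds 0)

/-- `n`-th Frobenius twist of a power series: coefficients raised to the `q^n` power. -/
def twist (q n : ℕ) (f : PowerSeries 𝕂) : PowerSeries 𝕂 :=
  PowerSeries.mk fun i => PowerSeries.coeff i f ^ q ^ n

/-- Entrywise Frobenius twist of a matrix of power series. -/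
def twistM {r : ℕ} (q n : ℕ) (M : Matrix (Fin r) (Fin r) (PowerSeries 𝕂)) :
    Matrix (Fin r) (Fin r) (PowerSeries 𝕂) :=
  Matrix.of fun i j => twist 𝕂 q n (M i j)

/-- Gauss norm of a matrix: maximum of the Gauss norms of the entries. -/
def mnorm {r : ℕ} (M : Matrix (Fin r) (Fin r) (PowerSeries 𝕂)) : ℝ :=
  ⨆ p : Fin r × Fin r, gnorm 𝕂 (M p.1 p.2)

/-- Membership in `GL_r(𝕋)`: all entries in `𝕋` and two-sided inverse with entries in `𝕋`. -/
def MemGLT {r : ℕ} (M : Matrix (Fin r) (Fin r) (PowerSeries 𝕂)) : Prop :=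
  (∀ i j, IsTate 𝕂 (M i j)) ∧
    ∃ C : Matrix (Fin r) (Fin r) (PowerSeries 𝕂),
      (∀ i j, IsTate 𝕂 (C i j)) ∧ M * C = 1 ∧ C * M = 1

/-- The matrix `Θ`, with entries viewed in `𝕂[[t]]`. -/
def ThetaPS (r : ℕ) (θ : 𝕂) (A : ℕ → 𝕂) : Matrix (Fin r) (Fin r) (PowerSeries 𝕂) :=
  Matrix.of fun i j =>
    if (i : ℕ) + 1 < r then (if (j : ℕ) = (i : ℕ) + 1 then 1 else 0)
    else if (j : ℕ) = 0 then (PowerSeries.X - PowerSeries.C θ) * PowerSeries.C (A r)⁻¹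
    else -(PowerSeries.C (A (j : ℕ)) * PowerSeries.C (A r)⁻¹)

/-- `h = φ_{t^{N−1}}(ξ) + φ_{t^{N−2}}(ξ) t + ⋯ + ξ t^{N−1}` viewed in `𝕂[[t]]`. -/
def hPS (q r N : ℕ) (θ : 𝕂) (A : ℕ → 𝕂) (ξ : 𝕂) : PowerSeries 𝕂 :=
  ∑ mm ∈ Finset.range N, PowerSeries.C ((phiT 𝕂 q r θ A)^[N - 1 - mm] ξ) * PowerSeries.X ^ mm

/-- The matrix `B = (h_j^{(i−1)})`. -/
def BPS (q r N : ℕ) (θ : 𝕂) (A : ℕ → 𝕂) (ξ : Fin r → 𝕂) :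
    Matrix (Fin r) (Fin r) (PowerSeries 𝕂) :=
  Matrix.of fun i j => twist 𝕂 q (i : ℕ) (hPS 𝕂 q r N θ A (ξ j))

/-- Partial products `F F^{(1)} ⋯ F^{(n)}` (successive factors multiplied on the right). -/
def prodTwists {r : ℕ} (q : ℕ) (F : Matrix (Fin r) (Fin r) (PowerSeries 𝕂)) (n : ℕ) :
    Matrix (Fin r) (Fin r) (PowerSeries 𝕂) :=
  ((List.range (n + 1)).map fun k => twistM 𝕂 q k F).prod

/-- Convergence of a sequence of matrices with respect to the Gauss norm. -/
def MTendsto {r : ℕ} (g : ℕ → Matrix (Fin r) (Fin r) (PowerSeries 𝕂))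
    (P : Matrix (Fin r) (Fin r) (PowerSeries 𝕂)) : Prop :=
  Tendsto (fun n => mnorm 𝕂 (g n - P)) atTop (nhds 0)

/-- Shadowed partitions: `(S_1, …, S_r) ∈ P_r(n)` iff `S_i ⊆ {0, …, n−1}` and the translates
`S_i + j`, `0 ≤ j ≤ i−1`, partition `{0, …, n−1}` (here `S i` is the paper's `S_{i+1}`). -/
def IsShadow (r n : ℕ) (S : Fin r → Finset ℕ) : Prop :=
  (∀ i, S i ⊆ Finset.range n) ∧
    ∀ x ∈ Finset.range n, ∃! p : Fin r × ℕ, p.2 ≤ (p.1 : ℕ) ∧ ∃ y ∈ S p.1, x = y + p.2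

open Classical in
/-- The (finite) set `P_r(n)` of shadowed partitions. -/
def shadowFinset (r n : ℕ) : Finset (Fin r → Finset ℕ) :=
  (Fintype.piFinset fun _ : Fin r => (Finset.range n).powerset).filter (IsShadow r n)

/-- `𝓑_n(t)` as an element of `𝕂[[t]]` (expanded on the unit disk). -/
def BnPS (q r : ℕ) (θ : 𝕂) (A : ℕ → 𝕂) (n : ℕ) : PowerSeries 𝕂 :=
  ∑ S ∈ shadowFinset r n, ∏ i : Fin r, ∏ j ∈ S i,
    PowerSeries.C (A ((i : ℕ) + 1) ^ q ^ j) *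
      (PowerSeries.X - PowerSeries.C (θ ^ q ^ ((i : ℕ) + 1 + j)))⁻¹

/-- Partial sums of `ℒ_φ(ξ;t) = Σ_n 𝓑_n(t) ξ^{q^n}`. -/
def LPartial (q r : ℕ) (θ : 𝕂) (A : ℕ → 𝕂) (ξ : 𝕂) (n : ℕ) : PowerSeries 𝕂 :=
  ∑ k ∈ Finset.range (n + 1), BnPS 𝕂 q r θ A k * PowerSeries.C (ξ ^ q ^ k)

/-- The exponential function `exp_φ(z) = Σ α_n z^{q^n}`. -/
def expF (q : ℕ) (α : ℕ → 𝕂) (z : 𝕂) : 𝕂 := ∑' n : ℕ, α n * z ^ q ^ n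

/-- Anderson generating function `f_φ(u;t) = Σ_m exp_φ(u/θ^{m+1}) t^m`. -/
def AGF (q : ℕ) (α : ℕ → 𝕂) (θ u : 𝕂) : PowerSeries 𝕂 :=
  PowerSeries.mk fun mm => expF 𝕂 q α (u / θ ^ (mm + 1))

/-- The subring `A = 𝔽_q[θ]` of `𝕂`. -/
def Asubring (q : ℕ) (θ : 𝕂) : Subring 𝕂 :=
  Subring.closure ({θ} ∪ {c : 𝕂 | c ^ q = c})

/-- `π_1, …, π_r` is an `A`-basis of the period lattice `Λ_φ = ker exp_φ`. -/
def IsPeriodBasis (q r : ℕ) (α : ℕ → 𝕂) (θ : 𝕂) (π : Fin r → 𝕂) : Prop :=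
  (∀ j, expF 𝕂 q α (π j) = 0) ∧
    ∀ z, expF 𝕂 q α z = 0 →
      ∃! a : Fin r → 𝕂, (∀ j, a j ∈ Asubring 𝕂 q θ) ∧ z = ∑ j, a j * π j

/-- Frobenius twist on `𝕂(t)`, induced by a Frobenius endomorphism of `𝕂`. -/
def twistRF (frobq : 𝕂 →+* 𝕂) : RatFunc 𝕂 →+* RatFunc 𝕂 :=
  RatFunc.mapRingHom (Polynomial.mapRingHom frobq) (by
    intro pp hpp
    simp only [Submonoid.mem_comap, Polynomial.coe_mapRingHom]
    rw [mem_nonZeroDivisors_iff_ne_zero] at hpp ⊢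
    exact (Polynomial.map_ne_zero_iff frobq.injective).mpr hpp)

/-- Entrywise `n`-fold Frobenius twist of a matrix over `𝕂(t)`. -/
def twistMRF {r : ℕ} (frobq : 𝕂 →+* 𝕂) (n : ℕ)
    (M : Matrix (Fin r) (Fin r) (RatFunc 𝕂)) : Matrix (Fin r) (Fin r) (RatFunc 𝕂) :=
  Matrix.of fun i j => (fun g => twistRF 𝕂 frobq g)^[n] (M i j)

/-- The matrix `Θ`, with entries viewed in `𝕂(t)`. -/
def ThetaRF (r : ℕ) (θ : 𝕂) (A : ℕ → 𝕂) : Matrix (Fin r) (Fin r) (RatFunc 𝕂) :=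
  Matrix.of fun i j =>
    if (i : ℕ) + 1 < r then (if (j : ℕ) = (i : ℕ) + 1 then 1 else 0)
    else if (j : ℕ) = 0 then (RatFunc.X - RatFunc.C θ) / RatFunc.C (A r)
    else -(RatFunc.C (A (j : ℕ)) / RatFunc.C (A r))

/-- `h` as an element of `𝕂(t)`. -/
def hRF (q r N : ℕ) (θ : 𝕂) (A : ℕ → 𝕂) (ξ : 𝕂) : RatFunc 𝕂 :=
  ∑ mm ∈ Finset.range N, RatFunc.C ((phiT 𝕂 q r θ A)^[N - 1 - mm] ξ) * RatFunc.X ^ mm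

/-- The matrix `B = (h_j^{(i−1)})` over `𝕂(t)`. -/
def BRF (q r N : ℕ) (frobq : 𝕂 →+* 𝕂) (θ : 𝕂) (A : ℕ → 𝕂) (ξ : Fin r → 𝕂) :
    Matrix (Fin r) (Fin r) (RatFunc 𝕂) :=
  Matrix.of fun i j => (fun g => twistRF 𝕂 frobq g)^[(i : ℕ)] (hRF 𝕂 q r N θ A (ξ j))

/-- The matrix `W` with first row `(ξ_1, …, ξ_r)` and all other entries `0`. -/
def WRF (r : ℕ) (ξ : Fin r → 𝕂) : Matrix (Fin r) (Fin r) (RatFunc 𝕂) :=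
  Matrix.of fun i j => if (i : ℕ) = 0 then RatFunc.C (ξ j) else 0

/-- `R_0 = I/(t−θ)` and `R_m = Θ^{−1}(Θ^{−1})^{(1)} ⋯ (Θ^{−1})^{(m−1)}/(t−θ^{q^m})`. -/
def RmRF (r : ℕ) (frobq : 𝕂 →+* 𝕂) (q : ℕ) (θ : 𝕂) (A : ℕ → 𝕂) (mm : ℕ) :
    Matrix (Fin r) (Fin r) (RatFunc 𝕂) :=
  (RatFunc.X - RatFunc.C (θ ^ q ^ mm))⁻¹ •
    ((List.range mm).map fun k => twistMRF 𝕂 frobq k (ThetaRF 𝕂 r θ A)⁻¹).prod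

/-- `𝓑_n(t)` as an element of `𝕂(t)`. -/
def BnRF (q r : ℕ) (θ : 𝕂) (A : ℕ → 𝕂) (n : ℕ) : RatFunc 𝕂 :=
  ∑ S ∈ shadowFinset r n, ∏ i : Fin r, ∏ j ∈ S i,
    RatFunc.C (A ((i : ℕ) + 1) ^ q ^ j) / (RatFunc.X - RatFunc.C (θ ^ q ^ ((i : ℕ) + 1 + j)))

/-- `𝓑_n(t)` for integer `n`, with `𝓑_n = 0` for `n < 0`. -/
def BnRFZ (q r : ℕ) (θ : 𝕂) (A : ℕ → 𝕂) (n : ℤ) : RatFunc 𝕂 :=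
  if n < 0 then 0 else BnRF 𝕂 q r θ A n.toNat

/-- `F = B^{−1} Θ^{−1} B^{(1)}` over `𝕂(t)`. -/
def FRF (q r N : ℕ) (frobq : 𝕂 →+* 𝕂) (θ : 𝕂) (A : ℕ → 𝕂) (ξ : Fin r → 𝕂) :
    Matrix (Fin r) (Fin r) (RatFunc 𝕂) :=
  (BRF 𝕂 q r N frobq θ A ξ)⁻¹ * (ThetaRF 𝕂 r θ A)⁻¹ *
    twistMRF 𝕂 frobq 1 (BRF 𝕂 q r N frobq θ A ξ)

/-- `Π_n = B F F^{(1)} ⋯ F^{(n)}` over `𝕂(t)`. -/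
def PiNRF (q r N : ℕ) (frobq : 𝕂 →+* 𝕂) (θ : 𝕂) (A : ℕ → 𝕂) (ξ : Fin r → 𝕂) (n : ℕ) :
    Matrix (Fin r) (Fin r) (RatFunc 𝕂) :=
  BRF 𝕂 q r N frobq θ A ξ *
    ((List.range (n + 1)).map fun k => twistMRF 𝕂 frobq k (FRF 𝕂 q r N frobq θ A ξ)).prod

set_option linter.unusedSectionVars false

section Helpers1

variable {K : Type} [NontriviallyNormedField K]

/-- All coefficients are bounded by `c`. -/
def Bd (c : ℝ) (f : PowerSeries K) : Prop := ∀ i, ‖PowerSeries.coeff i f‖ ≤ c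

/-- Entrywise bound. -/
def MBd {r : ℕ} (c : ℝ) (M : Matrix (Fin r) (Fin r) (PowerSeries K)) : Prop := ∀ i j, Bd c (M i j)

/-- Entrywise Tate. -/
def MT {r : ℕ} (M : Matrix (Fin r) (Fin r) (PowerSeries K)) : Prop := ∀ i j, IsTate K (M i j)

theorem Bd.nonneg {c : ℝ} {f : PowerSeries K} (h : Bd c f) : 0 ≤ c :=
  (norm_nonneg _).trans (h 0)

theorem Bd.mono {c d : ℝ} {f : PowerSeries K} (h : Bd c f) (hcd : c ≤ d) : Bd d f :=
  fun i => (h i).trans hcd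

theorem Bd.neg {c : ℝ} {f : PowerSeries K} (h : Bd c f) : Bd c (-f) := by
  intro i; simpa using h i

theorem Bd.zero {c : ℝ} (hc : 0 ≤ c) : Bd c (0 : PowerSeries K) := by
  intro i; simpa using hc

theorem Bd.C (c : K) : Bd ‖c‖ (PowerSeries.C c) := by
  intro i
  rw [PowerSeries.coeff_C]
  split_ifs <;> simp

theorem Bd.one : Bd 1 (1 : PowerSeries K) := by
  have := Bd.C (1 : K)
  simpa using this

theorem Bd.X_pow (n : ℕ) : Bd 1 (PowerSeries.X ^ n : PowerSeries K) := by
  intro i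
  rw [PowerSeries.coeff_X_pow]
  split_ifs <;> simp

theorem tate_of_eventually_zero {f : PowerSeries K} (n : ℕ)
    (h : ∀ i, n ≤ i → PowerSeries.coeff i f = 0) : IsTate K f := by
  refine tendsto_const_nhds.congr' ?_
  filter_upwards [eventually_ge_atTop n] with i hi
  rw [h i hi, norm_zero]

theorem tate_C (c : K) : IsTate K (PowerSeries.C c) :=
  tate_of_eventually_zero 1 fun i hi => by
    rw [PowerSeries.coeff_C, if_neg (by lia)]

theorem tate_X_pow (n : ℕ) : IsTate K (PowerSeries.X ^ n) :=
  tate_of_eventually_zero (n + 1) fun i hi => by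
    rw [PowerSeries.coeff_X_pow, if_neg (by lia)]

theorem tate_bd {f : PowerSeries K} (h : IsTate K f) : ∃ c, Bd c f := by
  obtain ⟨c, hc⟩ := h.bddAbove_range
  exact ⟨c, fun i => hc ⟨i, rfl⟩⟩

theorem eq_of_bd {f g : PowerSeries K} (h : ∀ ε > 0, Bd ε (f - g)) : f = g := by
  ext i
  rw [← sub_eq_zero, ← norm_le_zero_iff]
  refine le_of_forall_pos_le_add fun ε hε => ?_
  simpa using h ε hε i

theorem exists_kappa {ι : Type} [Fintype ι] (f : ι → ℝ) (h : ∀ i, f i < 1) :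
    ∃ κ : ℝ, 0 ≤ κ ∧ κ < 1 ∧ ∀ i, f i ≤ κ := by
  rcases isEmpty_or_nonempty ι with hi | hi
  · exact ⟨0, le_rfl, one_pos, fun i => (IsEmpty.false i).elim⟩
  · obtain ⟨i, hi⟩ := Finite.exists_max f
    exact ⟨max 0 (f i), le_max_left _ _, max_lt one_pos (h i), fun j => (hi j).trans (le_max_right _ _)⟩

variable [IsUltrametricDist K]

theorem Bd.add {c : ℝ} {f g : PowerSeries K} (hf : Bd c f) (hg : Bd c g) : Bd c (f + g) := by
  intro i
  rw [map_add]
  exact (IsUltrametricDist.norm_add_le_max _ _).trans (max_le (hf i) (hg i))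

theorem Bd.sub {c : ℝ} {f g : PowerSeries K} (hf : Bd c f) (hg : Bd c g) : Bd c (f - g) := by
  rw [sub_eq_add_neg]; exact hf.add hg.neg

theorem Bd.mul {c d : ℝ} {f g : PowerSeries K} (hf : Bd c f) (hg : Bd d g) :
    Bd (c * d) (f * g) := by
  intro i
  rw [PowerSeries.coeff_mul]
  refine IsUltrametricDist.norm_sum_le_of_forall_le_of_nonneg (mul_nonneg hf.nonneg hg.nonneg) ?_
  intro p _
  rw [norm_mul]
  exact mul_le_mul (hf _) (hg _) (norm_nonneg _) hf.nonneg

theorem Bd.sum {ι : Type} {c : ℝ} (hc : 0 ≤ c) (s : Finset ι) (f : ι → PowerSeries K)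
    (h : ∀ i ∈ s, Bd c (f i)) : Bd c (∑ i ∈ s, f i) := by
  intro i
  rw [map_sum]
  exact IsUltrametricDist.norm_sum_le_of_forall_le_of_nonneg hc fun j hj => h j hj i

theorem Bd.prod {ι : Type} (s : Finset ι) (c : ι → ℝ) (f : ι → PowerSeries K)
    (h : ∀ i ∈ s, Bd (c i) (f i)) : Bd (∏ i ∈ s, c i) (∏ i ∈ s, f i) := by
  classical
  induction s using Finset.induction_on with
  | empty => simpa using Bd.one
  | insert a s ha ih =>
    rw [Finset.prod_insert ha, Finset.prod_insert ha]
    exact (h a (by simp)).mul (ih fun i hi => h i (by simp [hi]))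

/-- Perturbation of a product. -/
theorem Bd.prod_sub {ι : Type} (s : Finset ι) (c : ι → ℝ) (f g : ι → PowerSeries K) {κ : ℝ}
    (hκ : 0 ≤ κ) (hf : ∀ i ∈ s, Bd (c i) (f i)) (hg : ∀ i ∈ s, Bd (c i) (g i))
    (h : ∀ i ∈ s, Bd (κ * c i) (f i - g i)) :
    Bd (κ * ∏ i ∈ s, c i) (∏ i ∈ s, f i - ∏ i ∈ s, g i) := by
  classical
  induction s using Finset.induction_on with
  | empty => simpa using Bd.zero hκ
  | insert a s ha ih =>
    rw [Finset.prod_insert ha, Finset.prod_insert ha, Finset.prod_insert ha]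
    have e : f a * ∏ i ∈ s, f i - g a * ∏ i ∈ s, g i =
      (f a - g a) * ∏ i ∈ s, f i + g a * (∏ i ∈ s, f i - ∏ i ∈ s, g i) := by ring
    rw [e]
    refine Bd.add ?_ ?_
    · have := (h a (by simp)).mul (Bd.prod s c f fun i hi => hf i (by simp [hi]))
      rwa [mul_assoc] at this
    · have := (hg a (by simp)).mul (ih (fun i hi => hf i (by simp [hi]))
        (fun i hi => hg i (by simp [hi])) (fun i hi => h i (by simp [hi])))
      rwa [mul_left_comm] at this

theorem tate_add {f g : PowerSeries K} (hf : IsTate K f) (hg : IsTate K g) : IsTate K (f + g) := by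
  have := hf.add hg
  rw [add_zero] at this
  refine squeeze_zero (fun _ => norm_nonneg _) (fun i => ?_) this
  rw [map_add]; exact norm_add_le _ _

theorem tate_neg {f : PowerSeries K} (hf : IsTate K f) : IsTate K (-f) := by
  unfold IsTate at *
  simpa using hf

theorem tate_iff {f : PowerSeries K} : IsTate K f ↔
    ∀ ε > 0, ∃ n, ∀ i, n ≤ i → ‖PowerSeries.coeff i f‖ ≤ ε := by
  unfold IsTate
  constructor
  · intro h ε hε
    have := h.eventually_le_const hε
    rw [eventually_atTop] at this
    exact this
  · intro h
    rw [Metric.tendsto_atTop]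
    intro ε hε
    obtain ⟨n, hn⟩ := h (ε / 2) (by positivity)
    refine ⟨n, fun i hi => ?_⟩
    rw [Real.dist_eq, sub_zero, abs_norm]
    linarith [hn i hi]

theorem tate_mul {f g : PowerSeries K} (hf : IsTate K f) (hg : IsTate K g) : IsTate K (f * g) := by
  obtain ⟨c, hc⟩ := tate_bd hf
  obtain ⟨d, hd⟩ := tate_bd hg
  have hc0 := hc.nonneg
  have hd0 := hd.nonneg
  rw [tate_iff] at *
  intro ε hε
  obtain ⟨n, hn⟩ := hf (ε / (d + 1)) (by positivity)
  obtain ⟨m, hm⟩ := hg (ε / (c + 1)) (by positivity)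
  refine ⟨n + m, fun i hi => ?_⟩
  rw [PowerSeries.coeff_mul]
  refine IsUltrametricDist.norm_sum_le_of_forall_le_of_nonneg hε.le ?_
  intro p hp
  rw [Finset.HasAntidiagonal.mem_antidiagonal] at hp
  rw [norm_mul]
  rcases le_or_gt n p.1 with h | h
  · calc _ ≤ (ε / (d + 1)) * (d + 1) :=
        mul_le_mul (hn _ h) ((hd _).trans (by linarith)) (norm_nonneg _) (by positivity)
      _ = ε := by field_simp
  · calc _ ≤ (c + 1) * (ε / (c + 1)) :=
        mul_le_mul ((hc _).trans (by linarith)) (hm _ (by lia)) (norm_nonneg _) (by positivity)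
      _ = ε := by field_simp

/-- The Tate algebra as a subring. -/
def tateSR (K : Type) [NontriviallyNormedField K] [IsUltrametricDist K] :
    Subring (PowerSeries K) where
  carrier := {f | IsTate K f}
  mul_mem' := tate_mul
  add_mem' := tate_add
  neg_mem' := tate_neg
  zero_mem' := by simpa using tate_C (0 : K)
  one_mem' := by simpa using tate_C (1 : K)

theorem mem_tateSR {f : PowerSeries K} : f ∈ tateSR K ↔ IsTate K f := Iff.rfl

theorem tate_of_approx {f : PowerSeries K} (h : ∀ ε > 0, ∃ g, IsTate K g ∧ Bd ε (f - g)) :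
    IsTate K f := by
  rw [tate_iff]
  intro ε hε
  obtain ⟨g, hg, hfg⟩ := h ε hε
  rw [tate_iff] at hg
  obtain ⟨n, hn⟩ := hg ε hε
  refine ⟨n, fun i hi => ?_⟩
  have e : PowerSeries.coeff i f = PowerSeries.coeff i (f - g) + PowerSeries.coeff i g := by simp
  rw [e]
  exact (IsUltrametricDist.norm_add_le_max _ _).trans (max_le (hfg i) (hn i hi))

/-- Matrices. -/
theorem MBd.mono {r : ℕ} {c d : ℝ} {M : Matrix (Fin r) (Fin r) (PowerSeries K)} (h : MBd c M)
    (hcd : c ≤ d) : MBd d M := fun i j => (h i j).mono hcd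

theorem MBd.add {r : ℕ} {c : ℝ} {M M' : Matrix (Fin r) (Fin r) (PowerSeries K)} (h : MBd c M)
    (h' : MBd c M') : MBd c (M + M') := fun i j => (h i j).add (h' i j)

theorem MBd.sub {r : ℕ} {c : ℝ} {M M' : Matrix (Fin r) (Fin r) (PowerSeries K)} (h : MBd c M)
    (h' : MBd c M') : MBd c (M - M') := fun i j => (h i j).sub (h' i j)

theorem MBd.neg {r : ℕ} {c : ℝ} {M : Matrix (Fin r) (Fin r) (PowerSeries K)} (h : MBd c M) :
    MBd c (-M) := fun i j => (h i j).neg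

theorem MBd.one {r : ℕ} : MBd 1 (1 : Matrix (Fin r) (Fin r) (PowerSeries K)) := by
  intro i j
  rw [Matrix.one_apply]
  split_ifs
  · exact Bd.one
  · exact Bd.zero zero_le_one

theorem MBd.mul {r : ℕ} {c d : ℝ} {M M' : Matrix (Fin r) (Fin r) (PowerSeries K)} (h : MBd c M)
    (h' : MBd d M') : MBd (c * d) (M * M') := by
  intro i j
  rw [Matrix.mul_apply]
  exact Bd.sum (mul_nonneg (h i i).nonneg (h' i i).nonneg) _ _ fun k _ => (h i k).mul (h' k j)

theorem MBd.pow {r : ℕ} {c : ℝ} {M : Matrix (Fin r) (Fin r) (PowerSeries K)} (h : MBd c M)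
    (n : ℕ) : MBd (c ^ n) (M ^ n) := by
  induction n with
  | zero => simpa using MBd.one
  | succ n ih => rw [pow_succ, pow_succ]; exact ih.mul h

theorem MT.mul {r : ℕ} {M M' : Matrix (Fin r) (Fin r) (PowerSeries K)} (h : MT M)
    (h' : MT M') : MT (M * M') := by
  intro i j
  rw [Matrix.mul_apply]
  exact (tateSR K).sum_mem fun k _ => (tateSR K).mul_mem (h i k) (h' k j)

theorem MT.add {r : ℕ} {M M' : Matrix (Fin r) (Fin r) (PowerSeries K)} (h : MT M)
    (h' : MT M') : MT (M + M') := fun i j => tate_add (h i j) (h' i j)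

theorem MT.neg {r : ℕ} {M : Matrix (Fin r) (Fin r) (PowerSeries K)} (h : MT M) : MT (-M) :=
  fun i j => tate_neg (h i j)

theorem MT.one {r : ℕ} : MT (1 : Matrix (Fin r) (Fin r) (PowerSeries K)) := by
  intro i j
  rw [Matrix.one_apply]
  split_ifs
  · exact (tateSR K).one_mem
  · exact (tateSR K).zero_mem

theorem MT.pow {r : ℕ} {M : Matrix (Fin r) (Fin r) (PowerSeries K)} (h : MT M)
    (n : ℕ) : MT (M ^ n) := by
  induction n with
  | zero => simpa using MT.one
  | succ n ih => rw [pow_succ]; exact ih.mul h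

theorem MT.mbd {r : ℕ} {M : Matrix (Fin r) (Fin r) (PowerSeries K)} (h : MT M) :
    ∃ c, 0 ≤ c ∧ MBd c M := by
  choose c hc using fun p : Fin r × Fin r => tate_bd (h p.1 p.2)
  refine ⟨∑ p, c p, Finset.sum_nonneg fun p _ => (hc p).nonneg, fun i j => ?_⟩
  exact (hc (i, j)).mono (Finset.single_le_sum (f := c) (fun p _ => (hc p).nonneg)
    (Finset.mem_univ (i, j)))

theorem MT.det {r : ℕ} {M : Matrix (Fin r) (Fin r) (PowerSeries K)} (h : MT M) :
    IsTate K M.det := by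
  rw [Matrix.det_apply]
  refine (tateSR K).sum_mem fun σ _ => ?_
  rw [Units.smul_def]
  exact (tateSR K).zsmul_mem ((tateSR K).prod_mem fun i _ => h _ _) _

theorem MT.adjugate {r : ℕ} {M : Matrix (Fin r) (Fin r) (PowerSeries K)} (h : MT M) :
    MT M.adjugate := by
  intro i j
  rw [Matrix.adjugate_apply]
  refine MT.det fun a b => ?_
  rw [Matrix.updateRow_apply]
  split_ifs
  · rw [Pi.single_apply]
    split_ifs
    · exact (tateSR K).one_mem
    · exact (tateSR K).zero_mem
  · exact h _ _

/-- Completeness. -/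
theorem exists_limit [CompleteSpace K] {r : ℕ} (G : ℕ → Matrix (Fin r) (Fin r) (PowerSeries K))
    {ρ : ℝ} (h0 : 0 ≤ ρ) (h1 : ρ < 1) (c : ℝ) (hG : ∀ n, MBd (c * ρ ^ n) (G (n + 1) - G n))
    (hT : ∀ n, MT (G n)) :
    ∃ P, MT P ∧ ∀ n, MBd (c * ρ ^ n) (P - G n) := by
  have hle : ∀ i j k n m, n ≤ m →
      ‖PowerSeries.coeff k (G m i j) - PowerSeries.coeff k (G n i j)‖ ≤ c * ρ ^ n := by
    intro i j k n m hnm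
    induction m, hnm using Nat.le_induction with
    | base => simpa using (norm_nonneg _).trans (hG n i j k)
    | succ m hm ih =>
      have hc : 0 ≤ c := by simpa using (norm_nonneg _).trans (hG 0 i j k)
      have e : PowerSeries.coeff k (G (m + 1) i j) - PowerSeries.coeff k (G n i j) =
        PowerSeries.coeff k ((G (m + 1) - G m) i j) +
          (PowerSeries.coeff k (G m i j) - PowerSeries.coeff k (G n i j)) := by
        rw [Matrix.sub_apply, map_sub]; ring
      rw [e]
      refine (IsUltrametricDist.norm_add_le_max _ _).trans (max_le ((hG m i j k).trans ?_) ih)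
      exact mul_le_mul_of_nonneg_left (pow_le_pow_of_le_one h0 h1.le hm) hc
  have hlim : Tendsto (fun n : ℕ => c * ρ ^ n) atTop (nhds 0) := by
    simpa using (tendsto_pow_atTop_nhds_zero_of_lt_one h0 h1).const_mul c
  have hex : ∀ i j k, ∃ l, Tendsto (fun n => PowerSeries.coeff k (G n i j)) atTop (nhds l) := by
    intro i j k
    refine cauchySeq_tendsto_of_complete (cauchySeq_of_le_tendsto_0' _ ?_ hlim)
    intro n m hnm
    rw [dist_comm, dist_eq_norm]
    exact hle i j k n m hnm
  choose l hl using hex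
  have hb : ∀ n, MBd (c * ρ ^ n) (Matrix.of (fun i j => PowerSeries.mk (l i j)) - G n) := by
    intro n i j k
    rw [Matrix.sub_apply, map_sub, Matrix.of_apply, PowerSeries.coeff_mk]
    refine le_of_tendsto ((hl i j k).sub_const _).norm ?_
    filter_upwards [eventually_ge_atTop n] with m hm
    exact hle i j k n m hm
  refine ⟨_, fun i j => tate_of_approx fun ε hε => ?_, hb⟩
  obtain ⟨n, hn⟩ := (hlim.eventually_le_const hε).exists
  exact ⟨G n i j, hT n i j, (hb n i j).mono hn⟩

theorem mat_eq_of_bd {r : ℕ} {M M' : Matrix (Fin r) (Fin r) (PowerSeries K)} {c ρ : ℝ}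
    (h0 : 0 ≤ ρ) (h1 : ρ < 1) (h : ∀ n : ℕ, MBd (c * ρ ^ n) (M - M')) : M = M' := by
  have hlim : Tendsto (fun n : ℕ => c * ρ ^ n) atTop (nhds 0) := by
    simpa using (tendsto_pow_atTop_nhds_zero_of_lt_one h0 h1).const_mul c
  ext1 i j
  refine eq_of_bd fun ε hε => ?_
  obtain ⟨n, hn⟩ := (hlim.eventually_le_const hε).exists
  exact (h n i j).mono hn

theorem neumann [CompleteSpace K] {r : ℕ} (E : Matrix (Fin r) (Fin r) (PowerSeries K))
    {ρ : ℝ} (h0 : 0 ≤ ρ) (h1 : ρ < 1) (hE : MBd ρ E) (hT : MT E) :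
    ∃ P, MT P ∧ MBd 1 P ∧ (1 + E) * P = 1 := by
  obtain ⟨P, hP, hb⟩ := exists_limit (fun n => ∑ k ∈ Finset.range n, (-E) ^ k) h0 h1 1
    (by
      intro n
      simp only [Finset.sum_range_succ, add_sub_cancel_left, one_mul]
      exact hE.neg.pow n)
    (by
      intro n
      induction n with
      | zero =>
        intro i j
        exact (tateSR K).zero_mem
      | succ n ih => rw [Finset.sum_range_succ]; exact ih.add (hT.neg.pow n))
  refine ⟨P, hP, by simpa using hb 0, ?_⟩
  refine mat_eq_of_bd (c := 1) h0 h1 fun n => ?_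
  have e : (1 + E) * P - 1 = (1 + E) * (P - ∑ k ∈ Finset.range n, (-E) ^ k) + -(-E) ^ n := by
    have := mul_neg_geom_sum (-E) n
    rw [sub_neg_eq_add] at this
    rw [mul_sub, this]; abel
  rw [e]
  refine MBd.add ?_ ?_
  · have := (MBd.one.add (hE.mono h1.le)).mul (hb n)
    simpa using this
  · simpa using (hE.neg.pow n).neg

theorem unit_tate [CompleteSpace K] {f : PowerSeries K} {c : K} (hc : c ≠ 0) {κ : ℝ} (h0 : 0 ≤ κ)
    (h1 : κ < 1) (hT : IsTate K f) (h : Bd (κ * ‖c‖) (f - PowerSeries.C c)) :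
    ∃ g, IsTate K g ∧ Bd ‖c‖⁻¹ g ∧ f * g = 1 := by
  have hc' : ‖c‖ ≠ 0 := norm_ne_zero_iff.2 hc
  set u := PowerSeries.C c⁻¹ * (f - PowerSeries.C c) with hu
  have huT : IsTate K u := tate_mul (tate_C _) ((tateSR K).sub_mem hT (tate_C _))
  have hub : Bd κ u := by
    have := (Bd.C c⁻¹).mul h
    rw [norm_inv] at this
    exact this.mono (le_of_eq (by field_simp))
  obtain ⟨P, hP, hb, hm⟩ := neumann (r := 1) (Matrix.of fun _ _ => u) h0 h1 (fun _ _ => hub)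
    (fun _ _ => huT)
  refine ⟨PowerSeries.C c⁻¹ * P 0 0, tate_mul (tate_C _) (hP _ _), ?_, ?_⟩
  · have := (Bd.C c⁻¹).mul (hb 0 0)
    simpa using this
  · have h2 := congrFun (congrFun hm 0) 0
    have h3 : PowerSeries.C c⁻¹ * PowerSeries.C c = (1 : PowerSeries K) := by
      rw [← map_mul, inv_mul_cancel₀ hc, map_one]
    simp [Matrix.mul_apply, hu] at h2
    rw [mul_sub, h3, add_sub_cancel] at h2
    rw [← h2]; ring

theorem mtendsto_of_bd {r : ℕ} (hr : 0 < r) (G : ℕ → Matrix (Fin r) (Fin r) (PowerSeries K))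
    (P : Matrix (Fin r) (Fin r) (PowerSeries K)) (c : ℕ → ℝ) (hc : Tendsto c atTop (nhds 0))
    (h : ∀ n, MBd (c n) (G n - P)) : MTendsto K G P := by
  have : Nonempty (Fin r × Fin r) := ⟨(⟨0, hr⟩, ⟨0, hr⟩)⟩
  refine squeeze_zero (fun n => ?_) (fun n => ?_) hc
  · exact Real.iSup_nonneg fun p => Real.iSup_nonneg fun i => norm_nonneg _
  · exact ciSup_le fun p => ciSup_le fun i => h n p.1 p.2 i

end Helpers1

section Helpers2

variable {K : Type} [NontriviallyNormedField K]

theorem coeff_twist (q n : ℕ) (f : PowerSeries K) (i : ℕ) :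
    PowerSeries.coeff i (twist K q n f) = PowerSeries.coeff i f ^ q ^ n := by
  simp [twist]

/-- The twist as a ring homomorphism. -/
theorem exists_twist_hom (p e q : ℕ) (hp : p.Prime) (hcharp : CharP K p) (hqpe : q = p ^ e)
    (n : ℕ) : ∃ σ : PowerSeries K →+* PowerSeries K, ∀ f, twist K q n f = σ f := by
  have := Fact.mk hp
  have : ExpChar K p := ExpChar.prime hp
  refine ⟨PowerSeries.map (iterateFrobenius K p (e * n)), fun f => ?_⟩
  ext i
  rw [coeff_twist, PowerSeries.coeff_map, iterateFrobenius_def, hqpe, pow_mul]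

theorem twist_twist (q n k : ℕ) (f : PowerSeries K) :
    twist K q n (twist K q k f) = twist K q (k + n) f := by
  ext i
  rw [coeff_twist, coeff_twist, coeff_twist, ← pow_mul, pow_add]

theorem twistM_twistM {r : ℕ} (q n k : ℕ) (M : Matrix (Fin r) (Fin r) (PowerSeries K)) :
    twistM K q n (twistM K q k M) = twistM K q (k + n) M := by
  ext1 i j
  exact twist_twist q n k _

theorem twistM_zero {r : ℕ} (q : ℕ) (M : Matrix (Fin r) (Fin r) (PowerSeries K)) :
    twistM K q 0 M = M := by
  ext i j k
  simp [twistM, coeff_twist]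

theorem exists_twistM_hom (p e q : ℕ) (hp : p.Prime) (hcharp : CharP K p) (hqpe : q = p ^ e)
    (r n : ℕ) : ∃ σ : Matrix (Fin r) (Fin r) (PowerSeries K) →+* Matrix (Fin r) (Fin r)
      (PowerSeries K), ∀ f, twistM K q n f = σ f := by
  obtain ⟨σ, hσ⟩ := exists_twist_hom (K := K) p e q hp hcharp hqpe n
  refine ⟨σ.mapMatrix, fun f => ?_⟩
  ext1 i j
  simp [twistM, hσ]

theorem Bd.twist {c : ℝ} {f : PowerSeries K} (h : Bd c f) (q n : ℕ) :
    Bd (c ^ q ^ n) (twist K q n f) := by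
  intro i
  rw [coeff_twist, norm_pow]
  exact pow_le_pow_left₀ (norm_nonneg _) (h i) _

theorem MBd.twistM {r : ℕ} {c : ℝ} {M : Matrix (Fin r) (Fin r) (PowerSeries K)} (h : MBd c M)
    (q n : ℕ) : MBd (c ^ q ^ n) (twistM K q n M) := fun i j => (h i j).twist q n

theorem tate_twist {f : PowerSeries K} (h : IsTate K f) (q n : ℕ) (hq : 0 < q) :
    IsTate K (twist K q n f) := by
  have := Tendsto.pow h (q ^ n)
  rw [zero_pow (by positivity)] at this
  refine this.congr fun i => ?_
  rw [coeff_twist, norm_pow]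

theorem MT.twistM {r : ℕ} {M : Matrix (Fin r) (Fin r) (PowerSeries K)} (h : MT M)
    (q n : ℕ) (hq : 0 < q) : MT (twistM K q n M) := fun i j => tate_twist (h i j) q n hq

theorem prodTwists_zero {r : ℕ} (q : ℕ) (F : Matrix (Fin r) (Fin r) (PowerSeries K)) :
    prodTwists K q F 0 = F := by
  simp [prodTwists, twistM_zero]

theorem prodTwists_succ {r : ℕ} (q : ℕ) (F : Matrix (Fin r) (Fin r) (PowerSeries K)) (n : ℕ) :
    prodTwists K q F (n + 1) = prodTwists K q F n * twistM K q (n + 1) F := by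
  rw [prodTwists, List.range_succ, List.map_append, List.prod_append]
  simp [prodTwists]

theorem prodTwists_shift {r : ℕ} (p e q : ℕ) (hp : p.Prime) (hcharp : CharP K p) (hqpe : q = p ^ e)
    (F : Matrix (Fin r) (Fin r) (PowerSeries K)) (n : ℕ) :
    prodTwists K q F (n + 1) = F * twistM K q 1 (prodTwists K q F n) := by
  obtain ⟨σ, hσ⟩ := exists_twistM_hom (K := K) p e q hp hcharp hqpe r 1
  induction n with
  | zero => rw [prodTwists_succ, prodTwists_zero]
  | succ n ih =>
    conv_rhs => rw [prodTwists_succ]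
    rw [prodTwists_succ, ih, hσ (_ * _), map_mul, mul_assoc, ← hσ, ← hσ, twistM_twistM]

variable [IsUltrametricDist K]

/-- The abstract convergence result. -/
theorem main_conv [CompleteSpace K] (p e q : ℕ) (hp : p.Prime) (hcharp : CharP K p)
    (hqpe : q = p ^ e) (hq : 2 ≤ q) {r : ℕ} (hr : 0 < r)
    (B Bi Θ : Matrix (Fin r) (Fin r) (PowerSeries K)) (F E : Matrix (Fin r) (Fin r) (PowerSeries K))
    (hB : MT B) (hBi : MT Bi) (hBB : B * Bi = 1) (hΘ : MT Θ) (hF : F = 1 + E) (hE : MT E)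
    {ρ : ℝ} (h0 : 0 ≤ ρ) (h1 : ρ < 1) (hEb : MBd ρ E)
    (hfun : Θ * (B * F) = twistM K q 1 B) :
    ∃ P : Matrix (Fin r) (Fin r) (PowerSeries K),
      MTendsto K (fun n => B * prodTwists K q F n) P ∧ MemGLT K P ∧ twistM K q 1 P = Θ * P := by
  have hq0 : 0 < q := by lia
  have hk : ∀ k, twistM K q k F = 1 + twistM K q k E := by
    intro k
    obtain ⟨σ, hσ⟩ := exists_twistM_hom (K := K) p e q hp hcharp hqpe r k
    rw [hσ, hσ, hF, map_add, map_one]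
  have hFT : MT F := by rw [hF]; exact MT.one.add hE
  have hE1 : ∀ k, MBd (1 : ℝ) (twistM K q k E) := fun k =>
    (hEb.twistM q k).mono (pow_le_one₀ h0 h1.le)
  have hG1 : ∀ n, MBd 1 (prodTwists K q F n) := by
    intro n
    induction n with
    | zero =>
      rw [prodTwists_zero, hF]
      exact MBd.one.add (hEb.mono h1.le)
    | succ n ih =>
      rw [prodTwists_succ, hk]
      simpa using ih.mul (MBd.one.add (hE1 _))
  have hGT : ∀ n, MT (prodTwists K q F n) := by
    intro n
    induction n with
    | zero => rw [prodTwists_zero]; exact hFT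
    | succ n ih =>
      rw [prodTwists_succ]
      exact ih.mul (hFT.twistM q _ hq0)
  obtain ⟨G, hG, hGb⟩ := exists_limit (fun n => prodTwists K q F n) h0 h1 ρ (by
    intro n
    rw [prodTwists_succ, hk, mul_add, mul_one, add_sub_cancel_left]
    have := (hG1 n).mul (hEb.twistM q (n + 1))
    rw [one_mul] at this
    refine this.mono ?_
    rw [← pow_succ']
    refine pow_le_pow_of_le_one h0 h1.le ?_
    exact (Nat.lt_pow_self (by lia)).le) hGT
  have hlim : ∀ c : ℝ, Tendsto (fun n : ℕ => c * ρ ^ n) atTop (nhds 0) := fun c => by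
    simpa using (tendsto_pow_atTop_nhds_zero_of_lt_one h0 h1).const_mul c
  obtain ⟨b, hb0, hb⟩ := hB.mbd
  obtain ⟨t, ht0, ht⟩ := hΘ.mbd
  have hPb : ∀ n, MBd (b * ρ * ρ ^ n) (B * G - B * prodTwists K q F n) := by
    intro n
    rw [← mul_sub, mul_assoc]
    exact hb.mul (hGb n)
  have hGE : MBd ρ (G - 1) := by
    have h := hGb 0
    rw [prodTwists_zero] at h
    have h2 : G - 1 = (G - F) + E := by rw [hF]; abel
    rw [h2]
    refine MBd.add ?_ hEb
    simpa using h
  have hGET : MT (G - 1) := by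
    rw [sub_eq_add_neg]; exact hG.add MT.one.neg
  obtain ⟨C, hC, -, hGC⟩ := neumann (G - 1) h0 h1 hGE hGET
  rw [add_sub_cancel] at hGC
  refine ⟨B * G, ?_, ⟨hB.mul hG, C * Bi, hC.mul hBi, ?_, ?_⟩, ?_⟩
  · refine mtendsto_of_bd hr _ _ _ (hlim (b * ρ)) fun n => ?_
    rw [← neg_sub]
    exact (hPb n).neg
  · rw [mul_assoc, ← mul_assoc G, hGC, one_mul, hBB]
  · rw [mul_eq_one_comm, mul_assoc, ← mul_assoc G, hGC, one_mul, hBB]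
  · obtain ⟨σ, hσ⟩ := exists_twistM_hom (K := K) p e q hp hcharp hqpe r 1
    have hstep : ∀ n, twistM K q 1 (B * prodTwists K q F n) = Θ * (B * prodTwists K q F (n + 1)) := by
      intro n
      rw [prodTwists_shift p e q hp hcharp hqpe, ← mul_assoc B, ← mul_assoc Θ, hfun, hσ, hσ, hσ,
        map_mul]
    have hs : ∀ n, MBd (max ((b * ρ) ^ q) (t * (b * ρ)) * ρ ^ n)
        (twistM K q 1 (B * G) - Θ * (B * G)) := by
      intro n
      have e1 : twistM K q 1 (B * G) - Θ * (B * G) =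
        twistM K q 1 (B * G - B * prodTwists K q F n) -
          Θ * (B * G - B * prodTwists K q F (n + 1)) := by
        rw [mul_sub Θ, ← hstep, hσ, hσ, hσ, map_sub]
        abel
      rw [e1]
      have hρn : 0 ≤ ρ ^ n := pow_nonneg h0 n
      refine MBd.sub ?_ ?_
      · refine ((hPb n).twistM q 1).mono ?_
        rw [pow_one, mul_pow]
        refine mul_le_mul (le_max_left _ _) ?_ (by positivity)
          ((pow_nonneg (mul_nonneg hb0 h0) _).trans (le_max_left _ _))
        exact pow_le_of_le_one hρn (pow_le_one₀ h0 h1.le) hq0.ne'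
      · refine (ht.mul (hPb (n + 1))).mono ?_
        rw [← mul_assoc]
        refine mul_le_mul (le_max_right _ _) ?_ (by positivity)
          ((pow_nonneg (mul_nonneg hb0 h0) _).trans (le_max_left _ _))
        exact pow_le_pow_of_le_one h0 h1.le (Nat.le_succ n)
    exact mat_eq_of_bd h0 h1 hs

/-- Rearrangement bound. -/
theorem rearr {n : ℕ} (y : Fin n → ℝ) (hy : ∀ i, 0 < y i) (hm : Monotone y) (w : Fin n → ℕ)
    (hw : Monotone w) (σ : Equiv.Perm (Fin n)) :
    ∏ j, y j ^ w (σ j) ≤ ∏ j, y j ^ w j := by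
  have hpos : ∀ f : Fin n → ℕ, 0 < ∏ j, y j ^ f j := fun f =>
    Finset.prod_pos fun j _ => pow_pos (hy j) _
  rw [← Real.log_le_log_iff (hpos fun j => w (σ j)) (hpos w),
    Real.log_prod (fun j _ => (pow_pos (hy j) _).ne'),
    Real.log_prod (fun j _ => (pow_pos (hy j) _).ne')]
  simp only [Real.log_pow]
  have hmono : Monovary (fun j => Real.log (y j)) (fun j => (w j : ℝ)) := by
    refine Monotone.monovary ?_ ?_
    · intro a b hab
      exact Real.log_le_log (hy a) (hm hab)
    · intro a b hab
      exact Nat.cast_le.2 (hw hab)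
  have := hmono.sum_mul_comp_perm_le_sum_mul (σ := σ)
  simpa [mul_comm] using this

theorem Bd.sign_smul {n : ℕ} {c : ℝ} {f : PowerSeries K} (h : Bd c f) (σ : Equiv.Perm (Fin n)) :
    Bd c (Equiv.Perm.sign σ • f) := by
  rcases Int.units_eq_one_or (Equiv.Perm.sign σ) with h1 | h1 <;> rw [h1]
  · simpa using h
  · simpa [Units.smul_def] using h.neg

theorem det_bd {n : ℕ} (y : Fin n → ℝ) (hy : ∀ i, 0 < y i) (hm : Monotone y) (w : Fin n → ℕ)
    (hw : Monotone w) (M : Matrix (Fin n) (Fin n) (PowerSeries K))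
    (hM : ∀ i j, Bd (y j ^ w i) (M i j)) : Bd (∏ j, y j ^ w j) M.det := by
  rw [Matrix.det_apply]
  refine Bd.sum (Finset.prod_nonneg fun j _ => (pow_pos (hy j) _).le) _ _ fun σ _ => ?_
  refine Bd.sign_smul ?_ σ
  exact (Bd.prod _ _ _ fun j _ => hM (σ j) j).mono (rearr y hy hm w hw σ)

theorem det_sub_bd {n : ℕ} (y : Fin n → ℝ) (hy : ∀ i, 0 < y i) (hm : Monotone y) (w : Fin n → ℕ)
    (hw : Monotone w) (M M' : Matrix (Fin n) (Fin n) (PowerSeries K)) {κ : ℝ} (hκ : 0 ≤ κ)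
    (hM : ∀ i j, Bd (y j ^ w i) (M i j)) (hM' : ∀ i j, Bd (y j ^ w i) (M' i j))
    (hd : ∀ i j, Bd (κ * y j ^ w i) (M i j - M' i j)) :
    Bd (κ * ∏ j, y j ^ w j) (M.det - M'.det) := by
  rw [Matrix.det_apply, Matrix.det_apply, ← Finset.sum_sub_distrib]
  refine Bd.sum (mul_nonneg hκ (Finset.prod_nonneg fun j _ => (pow_pos (hy j) _).le)) _ _
    fun σ _ => ?_
  rw [← smul_sub]
  refine Bd.sign_smul ?_ σ
  refine (Bd.prod_sub _ (fun j => y j ^ w (σ j)) _ _ hκ (fun j _ => hM (σ j) j)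
    (fun j _ => hM' (σ j) j) (fun j _ => hd (σ j) j)).mono ?_
  exact mul_le_mul_of_nonneg_left (rearr y hy hm w hw σ) hκ

/-- Determinant of `Θ`. -/
theorem det_Theta (n : ℕ) (θ : K) (A : ℕ → K) :
    (ThetaPS K (n + 1) θ A).det =
      (-1) ^ n * ((PowerSeries.X - PowerSeries.C θ) * PowerSeries.C (A (n + 1))⁻¹) := by
  rw [Matrix.det_succ_column_zero, Finset.sum_eq_single (Fin.last n)]
  · have h1 : (ThetaPS K (n + 1) θ A).submatrix (Fin.last n).succAbove Fin.succ = 1 := by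
      ext1 i j
      have hij : ((j : ℕ) = (i : ℕ)) ↔ i = j := by rw [Fin.ext_iff, eq_comm]
      simp [ThetaPS, Matrix.one_apply, hij]
    rw [h1, Matrix.det_one, mul_one]
    simp [ThetaPS]
  · intro i _ hi
    have : (i : ℕ) < n := by
      have := i.2
      have h2 : (i : ℕ) ≠ n := fun h => hi (Fin.ext h)
      lia
    simp [ThetaPS, this]
  · simp

end Helpers2

section Helpers3

variable {K : Type} [NontriviallyNormedField K]

theorem newton_facts {q r : ℕ} (hq : 2 ≤ q) {θ : K} (hθ : ‖θ‖ = (q : ℝ)) {A : ℕ → K}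
    (ND : NewtonData K q r θ A) {m : ℕ} (hm : IsMuIndex K q r A m) (a : ℕ → ℝ)
    (ha : ∀ k, 1 ≤ k → k ≤ ND.s → ∀ j, ND.d (k - 1) ≤ j → j < ND.d k → a j = ND.lam k) :
    (∀ i j, i ≤ j → j < r → a i ≤ a j) ∧
    (∑ j ∈ Finset.range r, ((q : ℝ) ^ (j + 1) - (q : ℝ) ^ j) * a j = 1 - degK K q (A r)) ∧
    (∀ i, i < r → ∑ j ∈ Finset.range i, ((q : ℝ) ^ (j + 1) - (q : ℝ) ^ j) * a j
      - a i * (q : ℝ) ^ i - muPhi K q A m ≤ 1) := by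
  have hq1 : (1 : ℝ) < q := by exact_mod_cast hq
  have hd : ∀ k k', k ≤ k' → k' ≤ ND.s → ND.d k ≤ ND.d k' := by
    intro k k' hk
    induction k', hk using Nat.le_induction with
    | base => intro _; exact le_rfl
    | succ n hn ih => intro h; exact (ih (by lia)).trans (ND.d_mono n (by lia)).le
  have hlam : ∀ k k', 1 ≤ k → k ≤ k' → k' ≤ ND.s → ND.lam k ≤ ND.lam k' := by
    intro k k' h1 hk
    induction k', hk using Nat.le_induction with
    | base => intro _; exact le_rfl
    | succ n hn ih => intro h; exact (ih (by lia)).trans (ND.lam_mono n (by lia) (by lia)).le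
  have hblock : ∀ j, j < r → ∃ k, 1 ≤ k ∧ k ≤ ND.s ∧ ND.d (k - 1) ≤ j ∧ j < ND.d k := by
    intro j hj
    have hex : ∃ k, j < ND.d k := ⟨ND.s, by rw [ND.d_last]; exact hj⟩
    classical
    have h1 := Nat.find_spec hex
    have h0 : 1 ≤ Nat.find hex := by
      by_contra h
      have : Nat.find hex = 0 := by lia
      rw [this, ND.d_zero] at h1
      lia
    refine ⟨Nat.find hex, h0, Nat.find_min' hex (by rw [ND.d_last]; exact hj), ?_, h1⟩
    have := Nat.find_min hex (m := Nat.find hex - 1) (by lia)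
    lia
  set S : ℕ → ℝ := fun i => ∑ j ∈ Finset.range i, ((q : ℝ) ^ (j + 1) - (q : ℝ) ^ j) * a j with hS
  have hin : ∀ k, 1 ≤ k → k ≤ ND.s → ∀ i, ND.d (k - 1) ≤ i → i ≤ ND.d k →
      S i = S (ND.d (k - 1)) + ND.lam k * ((q : ℝ) ^ i - (q : ℝ) ^ ND.d (k - 1)) := by
    intro k hk hks i hi
    induction i, hi using Nat.le_induction with
    | base => intro _; ring
    | succ n hn ih =>
      intro h
      have h2 : S (n + 1) = S n + ((q : ℝ) ^ (n + 1) - (q : ℝ) ^ n) * a n :=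
        Finset.sum_range_succ _ _
      rw [h2, ih (by lia), ha k hk hks n hn (by lia)]
      ring
  have hslope : ∀ k, 1 ≤ k → k ≤ ND.s →
      ND.lam k * ((q : ℝ) ^ ND.d k - (q : ℝ) ^ ND.d (k - 1)) =
      degK K q (Acoef K θ A (ND.d (k - 1))) - degK K q (Acoef K θ A (ND.d k)) := by
    intro k hk hks
    have hlt : ND.d (k - 1) < ND.d k := by
      have := ND.d_mono (k - 1) (by lia)
      rwa [Nat.sub_add_cancel hk] at this
    have : (q : ℝ) ^ ND.d k - (q : ℝ) ^ ND.d (k - 1) ≠ 0 :=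
      (sub_pos.2 (pow_lt_pow_right₀ hq1 hlt)).ne'
    rw [ND.slope_eq k hk hks, div_mul_cancel₀ _ this]
  have hdθ : degK K q (Acoef K θ A 0) = 1 := by
    rw [Acoef, if_pos rfl, degK, hθ]
    exact Real.logb_self_eq_one hq1
  have hSd : ∀ k, k ≤ ND.s → S (ND.d k) = 1 - degK K q (Acoef K θ A (ND.d k)) := by
    intro k
    induction k with
    | zero => intro _; rw [ND.d_zero, hdθ]; simp [hS]
    | succ k ih =>
      intro h
      have h1 := hin (k + 1) (by lia) h (ND.d (k + 1)) (hd _ _ (by lia) h) le_rfl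
      rw [hslope (k + 1) (by lia) h] at h1
      simp only [Nat.add_sub_cancel] at h1
      rw [h1, ih (by lia)]
      ring
  have hr0 : 0 < r := lt_of_lt_of_le (lt_of_lt_of_le hm.1.1 le_rfl) hm.1.2.1
  have hAc : ∀ n, 0 < n → Acoef K θ A n = A n := fun n hn => by rw [Acoef, if_neg hn.ne']
  refine ⟨?_, ?_, ?_⟩
  · intro i j hij hj
    obtain ⟨k, hk1, hks, hkl, hku⟩ := hblock i (by lia)
    obtain ⟨k', hk1', hks', hkl', hku'⟩ := hblock j hj
    rw [ha k hk1 hks i hkl hku, ha k' hk1' hks' j hkl' hku']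
    refine hlam k k' hk1 ?_ hks'
    by_contra h
    have := hd k' (k - 1) (by lia) (by lia)
    lia
  · have := hSd ND.s le_rfl
    rw [ND.d_last, hAc r hr0] at this
    exact this
  · intro i hi
    obtain ⟨k, hk1, hks, hkl, hku⟩ := hblock i hi
    rw [ha k hk1 hks i hkl hku]
    change S i - _ - _ ≤ 1
    have e1 := hin k hk1 hks i hkl hku.le
    have e2 := hSd (k - 1) (by lia)
    have e3 := hslope k hk1 hks
    have hm0 : 0 < m := hm.1.1
    have e4 := ND.hull m hm.1.2.1 (by rw [hAc m hm0]; exact hm.1.2.2) k hk1 hks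
    rw [hAc m hm0] at e4
    have hqm : (1 : ℝ) < (q : ℝ) ^ m := one_lt_pow₀ hq1 hm0.ne'
    have e5 : degK K q (A m) = muPhi K q A m * ((q : ℝ) ^ m - 1) + (q : ℝ) ^ m := by
      rw [muPhi, div_mul_cancel₀ _ (sub_pos.2 hqm).ne']; ring
    have hs1 : 1 ≤ ND.s := ND.s_pos
    have hd1 : 0 < ND.d 1 := by
      have := ND.d_mono 0 ND.s_pos
      rw [ND.d_zero] at this
      simpa using this
    have hqd : (1 : ℝ) < (q : ℝ) ^ ND.d 1 := one_lt_pow₀ hq1 hd1.ne'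
    have e6 := ND.slope_eq 1 le_rfl hs1
    simp only [Nat.sub_self, ND.d_zero, hdθ, pow_zero, hAc _ hd1] at e6
    have e7 : muPhi K q A (ND.d 1) + ND.lam 1 = -1 := by
      rw [e6, muPhi, ← add_div, div_eq_iff (sub_pos.2 hqd).ne']; ring
    have e8 := hm.2.1 (ND.d 1) ⟨hd1, by
      have := hd 1 ND.s hs1 le_rfl
      rwa [ND.d_last] at this, ND.vertex_ne 1 le_rfl hs1⟩
    have e9 := hlam 1 k le_rfl hk1 hks
    have e10 : 0 ≤ (1 + muPhi K q A m + ND.lam k) * (q : ℝ) ^ m :=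
      mul_nonneg (by linarith) (by linarith)
    rw [e1, e2]
    rw [e5] at e4
    nlinarith

theorem moore_ne_zero (p e q : ℕ) (hp : p.Prime) (hcharp : CharP K p) (hqpe : q = p ^ e)
    {r : ℕ} (hr : 0 < r) (T M : Matrix (Fin r) (Fin r) K) (hT : T.det ≠ 0)
    (hTM : T * M = M.map (fun y => y ^ q))
    (hind : ∀ c : Fin r → K, (∀ j, c j ^ q = c j) → ∑ j, M ⟨0, hr⟩ j * c j = 0 → c = 0) :
    M.det ≠ 0 := by
  classical
  have := Fact.mk hp
  have : ExpChar K p := ExpChar.prime hp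
  intro hdet
  obtain ⟨v0, hv0, hMv0⟩ := Matrix.exists_mulVec_eq_zero_iff.2 hdet
  have hex : ∃ n, ∃ v : Fin r → K, v ≠ 0 ∧ M.mulVec v = 0 ∧
      (Finset.univ.filter fun j => v j ≠ 0).card = n := ⟨_, v0, hv0, hMv0, rfl⟩
  obtain ⟨v, hv, hMv, hcard⟩ := Nat.find_spec hex
  have hmin : ∀ w : Fin r → K, M.mulVec w = 0 →
      (Finset.univ.filter fun j => w j ≠ 0).card < (Finset.univ.filter fun j => v j ≠ 0).card →
      w = 0 := by
    intro w hw hlt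
    by_contra hne
    rw [hcard] at hlt
    exact Nat.find_min hex hlt ⟨w, hne, hw, rfl⟩
  obtain ⟨i, hi⟩ := Function.ne_iff.1 hv
  simp only [Pi.zero_apply] at hi
  set u : Fin r → K := (v i)⁻¹ • v with hu
  have hui : u i = 1 := by simp [hu, hi]
  have hMu : M.mulVec u = 0 := by rw [hu, Matrix.mulVec_smul, hMv, smul_zero]
  have hMuq : M.mulVec (fun j => u j ^ q) = 0 := by
    have h1 : T.mulVec (M.mulVec (fun j => u j ^ q)) = 0 := by
      rw [Matrix.mulVec_mulVec, hTM]
      ext k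
      have h2 := congrFun hMu k
      simp only [Matrix.mulVec, dotProduct, Pi.zero_apply] at h2
      have h3 := congrArg (iterateFrobenius K p e) h2
      rw [map_sum, map_zero] at h3
      simp only [iterateFrobenius_def, ← hqpe, mul_pow] at h3
      simpa [Matrix.mulVec, dotProduct] using h3
    exact Matrix.eq_zero_of_mulVec_eq_zero hT h1
  have hw : (fun j => u j ^ q) - u = 0 := by
    refine hmin _ (by rw [Matrix.mulVec_sub, hMuq, hMu, sub_zero]) ?_
    refine Finset.card_lt_card (Finset.ssubset_iff_subset_ne.2 ⟨?_, ?_⟩)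
    · intro j
      simp only [Finset.mem_filter, Finset.mem_univ, true_and]
      intro hj hvj
      apply hj
      have hq0 : q ≠ 0 := by rw [hqpe]; exact (pow_pos hp.pos e).ne'
      simp [hu, hvj, hq0]
    · intro h
      have : i ∈ Finset.univ.filter fun j => v j ≠ 0 := by simp [hi]
      rw [← h] at this
      simp [hui] at this
  have := hind u (fun j => by
    have := congrFun hw j
    simpa [sub_eq_zero] using this) (by
    have := congrFun hMu ⟨0, hr⟩
    simpa [Matrix.mulVec, dotProduct] using this)
  rw [this] at hui
  simp at hui

theorem phiT_zero {q r : ℕ} (hq : 0 < q) (θ : K) (A : ℕ → K) : phiT K q r θ A 0 = 0 := by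
  simp [phiT, hq.ne']

theorem coeff_hPS {q r N : ℕ} (θ : K) (A : ℕ → K) (ξ : K) (k : ℕ) :
    PowerSeries.coeff k (hPS K q r N θ A ξ) =
      if k < N then (phiT K q r θ A)^[N - 1 - k] ξ else 0 := by
  simp [hPS, PowerSeries.coeff_C_mul, PowerSeries.coeff_X_pow]

theorem hPS_fun {q r N : ℕ} (hq : 0 < q) (hN : 1 ≤ N) (θ : K) (A : ℕ → K) (ξ : K)
    (hξ : (phiT K q r θ A)^[N] ξ = 0) :
    PowerSeries.C θ * hPS K q r N θ A ξ +
      ∑ i ∈ Finset.Icc 1 r, PowerSeries.C (A i) * twist K q i (hPS K q r N θ A ξ) =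
    PowerSeries.X * hPS K q r N θ A ξ - PowerSeries.C ξ * PowerSeries.X ^ N := by
  ext k
  have hL : PowerSeries.coeff k (PowerSeries.C θ * hPS K q r N θ A ξ +
      ∑ i ∈ Finset.Icc 1 r, PowerSeries.C (A i) * twist K q i (hPS K q r N θ A ξ)) =
      phiT K q r θ A (PowerSeries.coeff k (hPS K q r N θ A ξ)) := by
    simp [phiT, PowerSeries.coeff_C_mul, coeff_twist]
  rw [hL, map_sub, PowerSeries.coeff_C_mul, PowerSeries.coeff_X_pow, coeff_hPS]
  rcases k with _ | k
  · rw [PowerSeries.coeff_zero_X_mul, if_pos (by lia), if_neg (by lia)]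
    rw [← Function.iterate_succ_apply' (phiT K q r θ A)]
    have : (N - 1 - 0).succ = N := by lia
    rw [this, hξ]; simp
  · rw [PowerSeries.coeff_succ_X_mul, coeff_hPS]
    rcases lt_trichotomy (k + 1) N with h | h | h
    · rw [if_pos h, if_pos (by lia), if_neg h.ne, ← Function.iterate_succ_apply' (phiT K q r θ A)]
      have : (N - 1 - (k + 1)).succ = N - 1 - k := by lia
      rw [this]; simp
    · rw [if_neg (by lia), if_pos (by lia), if_pos h, phiT_zero hq]
      have : N - 1 - k = 0 := by lia
      rw [this]; simp
    · rw [if_neg (by lia), if_neg (by lia), if_neg (by lia), phiT_zero hq]; simp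

end Helpers3

section Helpers4

variable {K : Type} [NontriviallyNormedField K]

theorem sum_succAbove_diff {n : ℕ} (q : ℝ) (a : ℕ → ℝ) (i : Fin (n + 1)) :
    ∑ j : Fin n, q ^ ((j : ℕ) + 1) * a (i.succAbove j : ℕ) - ∑ j : Fin (n + 1), q ^ (j : ℕ) * a j =
      ∑ j ∈ Finset.range i, (q ^ (j + 1) - q ^ j) * a j - a i * q ^ (i : ℕ) := by
  have h1 : ∀ j : Fin n, q ^ ((j : ℕ) + 1) * a (i.succAbove j : ℕ) -
      q ^ (i.succAbove j : ℕ) * a (i.succAbove j : ℕ) =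
      if (j : ℕ) < i then (q ^ ((j : ℕ) + 1) - q ^ (j : ℕ)) * a j else 0 := by
    intro j
    split_ifs with h
    · rw [Fin.succAbove_of_castSucc_lt i j (by rw [Fin.lt_def]; simpa using h)]
      simp only [Fin.val_castSucc]
      ring
    · rw [Fin.succAbove_of_le_castSucc i j (by rw [Fin.le_def]; simpa using h)]
      simp
  have h0 := Fin.sum_univ_succAbove (fun j : Fin (n + 1) => q ^ (j : ℕ) * a j) i
  have h3 : ∀ X Y Z : ℝ, X - (Y + Z) = X - Z - Y := fun X Y Z => by ring
  rw [h0, h3, ← Finset.sum_sub_distrib]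
  rw [Finset.sum_congr rfl fun j _ => h1 j,
    Fin.sum_univ_eq_sum_range (fun j => if j < (i : ℕ) then (q ^ (j + 1) - q ^ j) * a j else 0) n,
    ← Finset.sum_filter]
  have h2 : (Finset.range n).filter (fun j => j < (i : ℕ)) = Finset.range i := by
    ext j
    have := i.2
    simp only [Finset.mem_filter, Finset.mem_range]
    lia
  rw [h2]
  ring

theorem logb_prod_pow {n : ℕ} (q : ℝ) (y : Fin n → ℝ) (hy : ∀ j, 0 < y j) (w : Fin n → ℕ) :
    Real.logb q (∏ j, y j ^ w j) = ∑ j, (w j : ℝ) * Real.logb q (y j) := by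
  rw [Real.logb_prod _ _ (fun j _ => (pow_pos (hy j) _).ne')]
  simp only [Real.logb_pow]

theorem h_small {q r N : ℕ} (hq : 2 ≤ q) {θ : K} {A : ℕ → K} {m : ℕ} {x ξ : Fin r → K}
    (hξ : GoodXi K q r N θ A m x ξ) (j : Fin r) (hx : x j ≠ 0) (i : ℕ) (hi : i < N - 1) :
    ‖(phiT K q r θ A)^[i] (ξ j)‖ < ‖x j‖ := by
  obtain ⟨-, -, h2, h3⟩ := hξ j
  have hq1 : (1 : ℝ) < q := by exact_mod_cast hq
  have hne : ∀ i, i ≤ N - 1 → (phiT K q r θ A)^[i] (ξ j) ≠ 0 := by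
    intro i hi h
    apply hx
    rw [← h2]
    have e : N - 1 = (N - 1 - i) + i := by lia
    rw [e, Function.iterate_add_apply, h]
    exact Function.iterate_fixed (phiT_zero (by lia) θ A) _
  have hstep : ∀ i, i + 1 ≤ N - 1 →
      ‖(phiT K q r θ A)^[i] (ξ j)‖ < ‖(phiT K q r θ A)^[i + 1] (ξ j)‖ := by
    intro i hi
    have := h3 i hi
    rw [degK, degK] at this
    exact (Real.logb_lt_logb_iff hq1 (norm_pos_iff.2 (hne i (by lia)))
      (norm_pos_iff.2 (hne _ hi))).1 this
  have key : ∀ d i, i + (d + 1) = N - 1 → ‖(phiT K q r θ A)^[i] (ξ j)‖ < ‖x j‖ := by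
    intro d
    induction d with
    | zero =>
      intro i hi
      rw [← h2, ← hi]
      exact hstep i (by lia)
    | succ d ih =>
      intro i hi
      exact (hstep i (by lia)).trans (ih (i + 1) (by lia))
  exact key (N - 1 - i - 1) i (by lia)

theorem Theta_mul_sub {q n N : ℕ} (hq : 0 < q) (hN : 1 ≤ N) (θ : K) (A : ℕ → K)
    (hA : A (n + 1) ≠ 0) (ξ : Fin (n + 1) → K)
    (hξ : ∀ j, (phiT K q (n + 1) θ A)^[N] (ξ j) = 0) (g : PowerSeries K)
    (hg : (PowerSeries.X - PowerSeries.C θ) * g = 1)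
    (V : Matrix (Fin (n + 1)) (Fin (n + 1)) (PowerSeries K))
    (hV0 : ∀ j, V 0 j = PowerSeries.X ^ N * g * PowerSeries.C (ξ j))
    (hVs : ∀ (i : Fin n) j, V i.succ j = 0) :
    ThetaPS K (n + 1) θ A * (BPS K q (n + 1) N θ A ξ - V) =
      twistM K q 1 (BPS K q (n + 1) N θ A ξ) := by
  ext1 i j
  rw [Matrix.mul_apply]
  have hR : twistM K q 1 (BPS K q (n + 1) N θ A ξ) i j =
      twist K q ((i : ℕ) + 1) (hPS K q (n + 1) N θ A (ξ j)) := by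
    simp only [twistM, BPS, Matrix.of_apply]
    rw [twist_twist]
  rw [hR, Fin.sum_univ_succ]
  have hB : ∀ k, BPS K q (n + 1) N θ A ξ k j = twist K q (k : ℕ) (hPS K q (n + 1) N θ A (ξ j)) :=
    fun k => rfl
  simp only [Matrix.sub_apply, hV0, hVs, sub_zero, hB]
  set h := hPS K q (n + 1) N θ A (ξ j) with hh
  have ht0 : twist K q 0 h = h := by ext k; simp [coeff_twist]
  by_cases hi : (i : ℕ) + 1 < n + 1
  · have hi' : (i : ℕ) < n := by lia
    rw [Finset.sum_eq_single (⟨i, by lia⟩ : Fin n)]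
    · simp [ThetaPS, hi']
    · intro b _ hb
      have : (b : ℕ) ≠ i := fun hbi => hb (Fin.ext hbi)
      simp [ThetaPS, hi', this]
    · simp
  · have hin : (i : ℕ) = n := by have := i.2; lia
    have hf := hPS_fun hq hN θ A (ξ j) (hξ j)
    rw [← hh] at hf
    have hIcc : Finset.Icc 1 (n + 1) = Finset.Ico 1 (n + 2) := by
      ext k; simp only [Finset.mem_Icc, Finset.mem_Ico]; lia
    rw [hIcc, Finset.sum_Ico_eq_sum_range, show n + 2 - 1 = n + 1 by lia,
      Finset.sum_range_succ] at hf
    have hs : ∑ k : Fin n, ThetaPS K (n + 1) θ A i k.succ * twist K q (k.succ : ℕ) h =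
        - (∑ k ∈ Finset.range n, PowerSeries.C (A (1 + k)) * twist K q (1 + k) h) *
          PowerSeries.C (A (n + 1))⁻¹ := by
      rw [← Fin.sum_univ_eq_sum_range
        (fun k => PowerSeries.C (A (1 + k)) * twist K q (1 + k) h) n, neg_mul, Finset.sum_mul,
        ← Finset.sum_neg_distrib]
      refine Finset.sum_congr rfl fun k _ => ?_
      simp only [ThetaPS, Matrix.of_apply, if_neg hi, Fin.val_succ]
      rw [if_neg (by lia), add_comm (k : ℕ) 1]
      ring
    have h0 : ThetaPS K (n + 1) θ A i 0 =
        (PowerSeries.X - PowerSeries.C θ) * PowerSeries.C (A (n + 1))⁻¹ := by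
      simp only [ThetaPS, Matrix.of_apply, if_neg hi, Fin.val_zero, if_true]
    rw [hs, h0, hin, Fin.val_zero, ht0, add_comm n 1]
    rw [add_comm n 1] at hA
    have hc : PowerSeries.C (A (1 + n)) * PowerSeries.C (A (1 + n))⁻¹ = (1 : PowerSeries K) := by
      rw [← map_mul, mul_inv_cancel₀ hA, map_one]
    set T := twist K q (1 + n) h
    set c := PowerSeries.C (A (1 + n))
    set c' := PowerSeries.C (A (1 + n))⁻¹
    set Sm := ∑ k ∈ Finset.range n, PowerSeries.C (A (1 + k)) * twist K q (1 + k) h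
    linear_combination (-c') * hf + T * hc - PowerSeries.X ^ N * PowerSeries.C (ξ j) * c' * hg

variable [IsUltrametricDist K] [CompleteSpace K]

theorem main_aux (p e q : ℕ) (hp : p.Prime) (hcharp : CharP K p) (he : 0 < e) (hqpe : q = p ^ e)
    (θ : K) (hθ : ‖θ‖ = (q : ℝ)) (n : ℕ) (A : ℕ → K) (hAr : A (n + 1) ≠ 0)
    (ND : NewtonData K q (n + 1) θ A) (m : ℕ) (hm : IsMuIndex K q (n + 1) A m)
    (x : Fin (n + 1) → K) (hxb : IsFqBasis K q (n + 1) θ A x)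
    (hxs : IsStrict K q (n + 1) θ A ND x)
    (N : ℕ) (hN : 1 ≤ N) (ξ : Fin (n + 1) → K) (hξ : GoodXi K q (n + 1) N θ A m x ξ) :
    ∃ P : Matrix (Fin (n + 1)) (Fin (n + 1)) (PowerSeries K),
      MTendsto K
        (fun k => BPS K q (n + 1) N θ A ξ *
          prodTwists K q ((BPS K q (n + 1) N θ A ξ)⁻¹ * (ThetaPS K (n + 1) θ A)⁻¹ *
            twistM K q 1 (BPS K q (n + 1) N θ A ξ)) k) P ∧
      MemGLT K P ∧ twistM K q 1 P = ThetaPS K (n + 1) θ A * P := by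
  have hq : 2 ≤ q := by
    rw [hqpe]
    exact hp.two_le.trans (Nat.le_self_pow he.ne' p)
  have hq0 : 0 < q := by lia
  have hq1 : (1 : ℝ) < q := by exact_mod_cast hq
  have hqpos : (0 : ℝ) < q := by linarith
  have hθ0 : θ ≠ 0 := by
    intro h; rw [h, norm_zero] at hθ; linarith
  -- independence
  have hind : ∀ c : Fin (n + 1) → K, (∀ j, c j ^ q = c j) → ∑ j, c j * x j = 0 → c = 0 := by
    intro c hc hs
    obtain ⟨c0, -, hu⟩ := hxb.2 0 (phiT_zero hq0 θ A)
    rw [hu c ⟨hc, hs.symm⟩]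
    exact (hu 0 ⟨fun j => by simp [hq0.ne'], by simp⟩).symm
  have hx0 : ∀ j, x j ≠ 0 := by
    intro j hj
    have := hind (Pi.single j 1) (fun k => by
      rw [Pi.single_apply]
      split_ifs
      · simp
      · simp [hq0.ne']) (by simp [Pi.single_apply, hj])
    have h2 := congrFun this j
    simp at h2
  set y : Fin (n + 1) → ℝ := fun j => ‖x j‖ with hy
  have hypos : ∀ j, 0 < y j := fun j => norm_pos_iff.2 (hx0 j)
  -- Newton polygon facts
  set a : ℕ → ℝ := fun j => if h : j < n + 1 then degK K q (x ⟨j, h⟩) else 0 with ha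
  have haj : ∀ j : Fin (n + 1), a j = Real.logb q (y j) := by
    intro j
    simp only [ha]
    rw [dif_pos j.2]
    rfl
  obtain ⟨hN1, hN2, hN3⟩ := newton_facts hq hθ ND hm a (by
    intro k hk1 hks j hj1 hj2
    have hjr : j < n + 1 := by
      refine lt_of_lt_of_le hj2 ?_
      have : ∀ k', k ≤ k' → k' ≤ ND.s → ND.d k ≤ ND.d k' := by
        intro k' hk
        induction k', hk using Nat.le_induction with
        | base => intro _; exact le_rfl
        | succ n hn ih => intro h; exact (ih (by lia)).trans (ND.d_mono n (by lia)).le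
      have h2 := this ND.s hks le_rfl
      rwa [ND.d_last] at h2
    have := hxs k hk1 hks ⟨j, hjr⟩ hj1 hj2
    rw [← this]
    simp only [ha]
    rw [dif_pos hjr])
  have hymono : Monotone y := by
    intro i j hij
    have := hN1 i j hij j.2
    rw [haj, haj] at this
    exact (Real.logb_le_logb hq1 (hypos i) (hypos j)).1 this
  -- coefficients of h
  have hcoef0 : ∀ j, PowerSeries.coeff 0 (hPS K q (n + 1) N θ A (ξ j)) = x j := by
    intro j
    rw [coeff_hPS, if_pos (by lia), Nat.sub_zero]
    exact (hξ j).2.2.1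
  obtain ⟨κ, hκ0, hκ1, hκ⟩ := exists_kappa (fun jk : Fin (n + 1) × Fin N =>
    if (jk.2 : ℕ) = 0 then 0 else
      ‖PowerSeries.coeff (jk.2 : ℕ) (hPS K q (n + 1) N θ A (ξ jk.1))‖ / y jk.1) (by
    rintro ⟨j, k⟩
    dsimp only
    split_ifs with h
    · exact one_pos
    · rw [div_lt_one (hypos j), coeff_hPS, if_pos k.2]
      exact h_small hq hξ j (hx0 j) _ (by have := k.2; lia))
  have hcoef : ∀ j k, k ≠ 0 →
      ‖PowerSeries.coeff k (hPS K q (n + 1) N θ A (ξ j))‖ ≤ κ * y j := by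
    intro j k hk
    by_cases hkN : k < N
    · have := hκ (j, ⟨k, hkN⟩)
      simp only [if_neg hk] at this
      rwa [div_le_iff₀ (hypos j)] at this
    · rw [coeff_hPS, if_neg hkN, norm_zero]
      exact mul_nonneg hκ0 (hypos j).le
  have hhb : ∀ j, Bd (y j) (hPS K q (n + 1) N θ A (ξ j)) := by
    intro j k
    rcases eq_or_ne k 0 with rfl | hk
    · rw [hcoef0]
    · exact (hcoef j k hk).trans (mul_le_of_le_one_left (hypos j).le hκ1.le)
  set B := BPS K q (n + 1) N θ A ξ with hBdef
  have hBij : ∀ i j : Fin (n + 1), B i j = twist K q (i : ℕ) (hPS K q (n + 1) N θ A (ξ j)) := fun _ _ => rfl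
  have hBb : ∀ i j : Fin (n + 1), Bd (y j ^ q ^ (i : ℕ)) (B i j) := fun i j => (hhb j).twist q i
  have hBT : MT B := by
    intro i j
    refine tate_twist (tate_of_eventually_zero N fun k hk => ?_) _ _ hq0
    rw [coeff_hPS, if_neg (by lia)]
  set M : Matrix (Fin (n + 1)) (Fin (n + 1)) K := Matrix.of fun i j => x j ^ q ^ (i : ℕ) with hM
  have hMB : (PowerSeries.constantCoeff (R := K)).mapMatrix B = M := by
    ext i j
    rw [RingHom.mapMatrix_apply, Matrix.map_apply, hBij, ← PowerSeries.coeff_zero_eq_constantCoeff_apply,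
      coeff_twist, hcoef0]
    rfl
  set M' : Matrix (Fin (n + 1)) (Fin (n + 1)) (PowerSeries K) :=
    (PowerSeries.C (R := K)).mapMatrix M with hM'
  have hM'ij : ∀ i j : Fin (n + 1), M' i j = PowerSeries.C (x j ^ q ^ (i : ℕ)) := fun _ _ => rfl
  have hw : Monotone fun i : Fin (n + 1) => q ^ (i : ℕ) := by
    intro i j hij
    exact Nat.pow_le_pow_right hq0 hij
  -- inverse of X - θ
  obtain ⟨g, hgT, hgb, hg⟩ := unit_tate (f := PowerSeries.X - PowerSeries.C θ) (c := -θ)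
    (neg_ne_zero.2 hθ0) (κ := (q : ℝ)⁻¹) (by positivity) (inv_lt_one_of_one_lt₀ hq1)
    ((tateSR K).sub_mem (by simpa [mem_tateSR] using tate_X_pow (K := K) 1) (tate_C θ)) (by
      rw [norm_neg, hθ, inv_mul_cancel₀ hqpos.ne', map_neg, sub_neg_eq_add, sub_add_cancel]
      simpa using Bd.X_pow (K := K) 1)
  rw [norm_neg, hθ] at hgb
  -- the matrix V
  set V : Matrix (Fin (n + 1)) (Fin (n + 1)) (PowerSeries K) := Matrix.of fun i j =>
    if i = 0 then PowerSeries.X ^ N * g * PowerSeries.C (ξ j) else 0 with hV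
  have hV0 : ∀ j, V 0 j = PowerSeries.X ^ N * g * PowerSeries.C (ξ j) := fun j => by simp [hV]
  have hVs : ∀ (i : Fin n) j, V i.succ j = 0 := fun i j => by simp [hV, Fin.succ_ne_zero]
  have hΘB := Theta_mul_sub hq0 hN θ A hAr ξ (fun j => (hξ j).1) g hg V hV0 hVs
  rw [← hBdef] at hΘB
  have hVT : MT V := by
    intro i j
    refine Fin.cases ?_ (fun i => ?_) i
    · rw [hV0]
      exact tate_mul (tate_mul (tate_X_pow N) hgT) (tate_C _)
    · rw [hVs]; exact (tateSR K).zero_mem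
  set Θ := ThetaPS K (n + 1) θ A with hΘdef
  -- determinant of M
  set T := (PowerSeries.constantCoeff (R := K)).mapMatrix Θ with hT
  have hTM : T * M = M.map (fun z => z ^ q) := by
    have h1 := congrArg (PowerSeries.constantCoeff (R := K)).mapMatrix hΘB
    have h2 : (PowerSeries.constantCoeff (R := K)).mapMatrix V = 0 := by
      ext i j
      rw [RingHom.mapMatrix_apply, Matrix.map_apply]
      refine Fin.cases ?_ (fun i => ?_) i
      · rw [hV0]
        have : N ≠ 0 := by lia
        simp [this]
      · rw [hVs]; simp
    rw [map_mul, map_sub, h2, sub_zero, hMB, ← hT] at h1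
    rw [h1]
    ext i j
    rw [RingHom.mapMatrix_apply, Matrix.map_apply, Matrix.map_apply,
      ← PowerSeries.coeff_zero_eq_constantCoeff_apply]
    change PowerSeries.coeff 0 (twist K q 1 (B i j)) = _
    rw [coeff_twist, PowerSeries.coeff_zero_eq_constantCoeff_apply, pow_one, ← hMB]
    rfl
  have hTdet : T.det = (-1) ^ n * (-θ * (A (n + 1))⁻¹) := by
    rw [hT, ← RingHom.map_det, hΘdef, det_Theta]
    simp
  have hTne : T.det ≠ 0 := by
    rw [hTdet]
    exact mul_ne_zero (pow_ne_zero _ (by simp)) (mul_ne_zero (neg_ne_zero.2 hθ0) (inv_ne_zero hAr))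
  have hMne : M.det ≠ 0 := moore_ne_zero p e q hp hcharp hqpe (Nat.succ_pos n) T M hTne hTM (by
    intro c hc hs
    refine hind c hc ?_
    rw [← hs]
    refine Finset.sum_congr rfl fun j _ => ?_
    simp [hM, mul_comm])
  set D := ∏ j, y j ^ q ^ (j : ℕ) with hD
  have hDpos : 0 < D := Finset.prod_pos fun j _ => pow_pos (hypos j) _
  have hlogD : Real.logb q D = ∑ j : Fin (n + 1), (q : ℝ) ^ (j : ℕ) * a j := by
    rw [hD, logb_prod_pow _ _ hypos]
    refine Finset.sum_congr rfl fun j _ => ?_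
    rw [haj]; push_cast; rfl
  have hApos : 0 < ‖A (n + 1)‖ := norm_pos_iff.2 hAr
  have hMD : ‖M.det‖ = D := by
    have h1 : T.det * M.det = M.det ^ q := by
      rw [← Matrix.det_mul, hTM]
      have := Fact.mk hp
      have : ExpChar K p := ExpChar.prime hp
      have h2 := RingHom.map_det (iterateFrobenius K p e) M
      rw [iterateFrobenius_def, ← hqpe] at h2
      rw [h2]
      congr 1
      ext i j
      simp [iterateFrobenius_def, hqpe]
    have h2 : ‖M.det‖ ^ (q - 1) = q / ‖A (n + 1)‖ := by
      have h3 : M.det ^ q = M.det ^ (q - 1) * M.det := by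
        rw [← pow_succ, Nat.sub_add_cancel (by lia)]
      rw [h3] at h1
      have h4 := mul_right_cancel₀ hMne h1
      rw [← norm_pow, ← h4, hTdet]
      simp [hθ, div_eq_mul_inv]
    have h3 : D ^ (q - 1) = q / ‖A (n + 1)‖ := by
      refine Real.logb_injOn_pos hq1 (pow_pos hDpos _) (div_pos hqpos hApos) ?_
      rw [Real.logb_pow, Real.logb_div hqpos.ne' hApos.ne', Real.logb_self_eq_one hq1, hlogD]
      change _ = 1 - degK K q (A (n + 1))
      rw [← hN2, Nat.cast_sub (by lia), Nat.cast_one,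
        Fin.sum_univ_eq_sum_range (fun j => (q : ℝ) ^ j * a j) (n + 1), Finset.mul_sum]
      refine Finset.sum_congr rfl fun j _ => ?_
      ring
    exact (pow_left_inj₀ (norm_nonneg _) hDpos.le (by lia)).1 (h2.trans h3.symm)
  -- det B
  have hBM : ∀ i j : Fin (n + 1), Bd (κ * y j ^ q ^ (i : ℕ)) (B i j - M' i j) := by
    intro i j k
    rw [map_sub, hBij, hM'ij, coeff_twist, PowerSeries.coeff_C]
    rcases eq_or_ne k 0 with rfl | hk
    · rw [if_pos rfl, hcoef0, sub_self, norm_zero]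
      exact mul_nonneg hκ0 (pow_pos (hypos j) _).le
    · rw [if_neg hk, sub_zero, norm_pow]
      refine (pow_le_pow_left₀ (norm_nonneg _) (hcoef j k hk) _).trans ?_
      rw [mul_pow]
      exact mul_le_mul_of_nonneg_right (pow_le_of_le_one hκ0 hκ1.le (by positivity))
        (pow_pos (hypos j) _).le
  have hdetB : Bd (κ * ‖M.det‖) (B.det - PowerSeries.C M.det) := by
    rw [hMD, RingHom.map_det]
    refine det_sub_bd y hypos hymono (fun i => q ^ (i : ℕ)) hw B M' hκ0 hBb (fun i j => ?_) hBM
    rw [hM'ij]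
    refine (Bd.C _).mono (le_of_eq ?_)
    rw [norm_pow]
  obtain ⟨g', hgT', hgb', hg'⟩ := unit_tate hMne hκ0 hκ1 hBT.det hdetB
  rw [hMD] at hgb'
  set Bi := g' • B.adjugate with hBi
  have hBiT : MT Bi := fun i j => tate_mul hgT' (hBT.adjugate i j)
  have hBBi : B * Bi = 1 := by
    rw [hBi, Matrix.mul_smul, Matrix.mul_adjugate, smul_smul, mul_comm, hg', one_smul]
  have hBiB : Bi * B = 1 := mul_eq_one_comm.1 hBBi
  have hBinv : B⁻¹ = Bi := Matrix.inv_eq_right_inv hBBi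
  have hΘT : MT Θ := by
    intro i j
    simp only [hΘdef, ThetaPS, Matrix.of_apply]
    have hX : (PowerSeries.X : PowerSeries K) ∈ tateSR K := by
      simpa [mem_tateSR] using tate_X_pow (K := K) 1
    have hC : ∀ c : K, PowerSeries.C c ∈ tateSR K := tate_C
    change _ ∈ tateSR K
    split_ifs
    · exact (tateSR K).one_mem
    · exact (tateSR K).zero_mem
    · exact (tateSR K).mul_mem ((tateSR K).sub_mem hX (hC _)) (hC _)
    · exact (tateSR K).neg_mem ((tateSR K).mul_mem (hC _) (hC _))
  have hΘu : IsUnit Θ.det := by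
    rw [hΘdef, det_Theta]
    refine IsUnit.mul (isUnit_one.neg.pow n) (IsUnit.mul ⟨⟨_, g, hg, by rw [mul_comm, hg]⟩, rfl⟩ ?_)
    exact (IsUnit.mk0 _ (inv_ne_zero hAr)).map PowerSeries.C
  have hF : B⁻¹ * Θ⁻¹ * twistM K q 1 B = 1 + -(Bi * V) := by
    rw [← hΘB, mul_assoc, ← mul_assoc Θ⁻¹, Matrix.nonsing_inv_mul _ hΘu, one_mul, hBinv, mul_sub,
      hBiB, sub_eq_add_neg]
  -- bound for E
  have hRpos : 0 < Rphi K q A m := Real.rpow_pos_of_pos hqpos _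
  obtain ⟨ρ, hρ0, hρ1, hρ⟩ := exists_kappa (fun j => ‖ξ j‖ / Rphi K q A m) (fun j => by
    rw [div_lt_one hRpos]; exact (hξ j).2.1)
  have hQ : ∀ i : Fin (n + 1),
      D⁻¹ * ∏ j : Fin n, y (i.succAbove j) ^ q ^ ((j : ℕ) + 1) ≤ q / Rphi K q A m := by
    intro i
    have hQpos : 0 < ∏ j : Fin n, y (i.succAbove j) ^ q ^ ((j : ℕ) + 1) :=
      Finset.prod_pos fun j _ => pow_pos (hypos _) _
    rw [← Real.logb_le_logb hq1 (mul_pos (inv_pos.2 hDpos) hQpos) (div_pos hqpos hRpos),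
      Real.logb_mul (inv_pos.2 hDpos).ne' hQpos.ne', Real.logb_inv,
      Real.logb_div hqpos.ne' hRpos.ne', Real.logb_self_eq_one hq1, hlogD,
      logb_prod_pow _ _ (fun j => hypos (i.succAbove j)), Rphi,
      Real.logb_rpow hqpos hq1.ne']
    have h1 := sum_succAbove_diff (q : ℝ) a i
    have h2 := hN3 i i.2
    simp only [haj] at h1
    simp only [← haj] at h1
    have h3 : ∑ j : Fin n, ((q ^ ((j : ℕ) + 1) : ℕ) : ℝ) * Real.logb q (y (i.succAbove j)) =
        ∑ j : Fin n, (q : ℝ) ^ ((j : ℕ) + 1) * a (i.succAbove j : ℕ) := by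
      refine Finset.sum_congr rfl fun j _ => ?_
      rw [haj]; push_cast; rfl
    rw [h3]
    linarith
  have hadj : ∀ i, Bd (∏ j : Fin n, y (i.succAbove j) ^ q ^ ((j : ℕ) + 1)) (B.adjugate i 0) := by
    intro i
    rw [Matrix.adjugate_fin_succ_eq_det_submatrix]
    have h1 := det_bd (fun j : Fin n => y (i.succAbove j)) (fun j => hypos _)
      (hymono.comp (Fin.strictMono_succAbove i).monotone) (fun j => q ^ ((j : ℕ) + 1))
      (fun j k hjk => Nat.pow_le_pow_right hq0 (Nat.succ_le_succ hjk))
      (B.submatrix (Fin.succAbove 0) i.succAbove) (fun k j => by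
        rw [Matrix.submatrix_apply]
        have := hBb (Fin.succAbove 0 k) (i.succAbove j)
        simpa using this)
    rcases neg_one_pow_eq_or (PowerSeries K) (((0 : Fin (n + 1)) : ℕ) + (i : ℕ)) with h | h <;> rw [h]
    · rw [one_mul]; exact h1
    · rw [neg_one_mul]; exact h1.neg
  have hEb : MBd ρ (-(Bi * V)) := by
    refine MBd.neg fun i j => ?_
    rw [Matrix.mul_apply, Fin.sum_univ_succ]
    simp only [hVs, mul_zero, Finset.sum_const_zero, add_zero]
    rw [hV0]
    have hb1 : Bd (q / Rphi K q A m) (Bi i 0) := (hgb'.mul (hadj i)).mono (hQ i)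
    have hb2 := ((Bd.X_pow (K := K) N).mul hgb).mul (Bd.C (ξ j))
    refine (hb1.mul hb2).mono (le_trans (le_of_eq ?_) (hρ j))
    field_simp
  rw [hF]
  exact main_conv p e q hp hcharp hqpe hq (Nat.succ_pos n) B Bi Θ _ (-(Bi * V)) hBT hBiT hBBi hΘT
    rfl (hBiT.mul hVT).neg hρ0 hρ1 hEb (by rw [← hF, hBinv, ← hΘB]; rw [
      mul_assoc Bi, ← mul_assoc Θ⁻¹, Matrix.nonsing_inv_mul _ hΘu, one_mul, ← mul_assoc B, hBBi,
      one_mul])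

end Helpers4

theorem stmt1
    (𝕂 : Type) [NontriviallyNormedField 𝕂] [CompleteSpace 𝕂] [IsAlgClosed 𝕂]
    (hna : ∀ x y : 𝕂, ‖x + y‖ ≤ max ‖x‖ ‖y‖)
    (p e q : ℕ) (hp : p.Prime) (hcharp : CharP 𝕂 p) (he : 0 < e) (hqpe : q = p ^ e)
    (θ : 𝕂) (hθ : ‖θ‖ = (q : ℝ))
    (r : ℕ) (hr : 0 < r) (A : ℕ → 𝕂) (hAr : A r ≠ 0)
    (ND : NewtonData 𝕂 q r θ A)
    (m : ℕ) (hm : IsMuIndex 𝕂 q r A m)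
    (x : Fin r → 𝕂) (hxb : IsFqBasis 𝕂 q r θ A x) (hxs : IsStrict 𝕂 q r θ A ND x)
    (N : ℕ) (hN : 1 ≤ N) (ξ : Fin r → 𝕂) (hξ : GoodXi 𝕂 q r N θ A m x ξ)
    :
    ∃ P : Matrix (Fin r) (Fin r) (PowerSeries 𝕂),
      MTendsto 𝕂
        (fun n => BPS 𝕂 q r N θ A ξ *
          prodTwists 𝕂 q ((BPS 𝕂 q r N θ A ξ)⁻¹ * (ThetaPS 𝕂 r θ A)⁻¹ *
            twistM 𝕂 q 1 (BPS 𝕂 q r N θ A ξ)) n) P ∧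
      MemGLT 𝕂 P ∧ twistM 𝕂 q 1 P = ThetaPS 𝕂 r θ A * P := by
  have : IsUltrametricDist 𝕂 := IsUltrametricDist.isUltrametricDist_of_forall_norm_add_le_max_norm hna
  obtain ⟨n, rfl⟩ : ∃ n, r = n + 1 := ⟨r - 1, by lia⟩
  exact main_aux p e q hp hcharp he hqpe θ hθ n A hAr ND m hm x hxb hxs N hN ξ hξ

end DrinfeldRAT
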